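/- arXiv:1310.5671 — 5 statements merged into one kernel-verified Lean document; each statement's English description precedes it below -/
import Mathlib

section
/- Let M ⊆ ℂⁿ be a closed set which is a Carleman continuum (i.e., M admits Carleman approximation by entire functions). Then M has bounded E-hulls: for every compact set K ⊆ ℂⁿ, the set h(K ∪ M) = (K ∪ M)^ \ (K ∪ M) is bounded. -/
open Set

noncomputable section

/-- Polynomial hull of a compact set `C ⊆ ℂⁿ`. -/
def polyHullCompact {n : ℕ} (C : Set (Fin n → ℂ)) : Set (Fin n → ℂ) :=
  {z | ∀ p : MvPolynomial (Fin n) ℂ,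
    ‖MvPolynomial.eval z p‖ ≤ sSup ((fun w => ‖MvPolynomial.eval w p‖) '' C)}

/-- Polynomial hull of a closed set `X ⊆ ℂⁿ`: union of hulls of compact subsets. -/
def polyHull {n : ℕ} (X : Set (Fin n → ℂ)) : Set (Fin n → ℂ) :=
  ⋃ C ∈ {C : Set (Fin n → ℂ) | IsCompact C ∧ C ⊆ X}, polyHullCompact C

/-- `h(X) = X̂ \ X`. -/
def hHull {n : ℕ} (X : Set (Fin n → ℂ)) : Set (Fin n → ℂ) := polyHull X \ X

/-- A closed set `X` is polynomially convex if `h(X) = ∅`. -/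
def IsPolyConvex {n : ℕ} (X : Set (Fin n → ℂ)) : Prop := hHull X = ∅

/-- `M` has bounded E-hulls if `h(K ∪ M)` is bounded for every compact `K`. -/
def HasBoundedEHulls {n : ℕ} (M : Set (Fin n → ℂ)) : Prop :=
  ∀ K : Set (Fin n → ℂ), IsCompact K → Bornology.IsBounded (hHull (K ∪ M))

/-- `M` is a Carleman continuum: entire functions approximate continuous functions
on `M` in the Whitney `C⁰` topology. -/
def IsCarleman {n : ℕ} (M : Set (Fin n → ℂ)) : Prop :=
  ∀ f : (Fin n → ℂ) → ℂ, ContinuousOn f M →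
  ∀ ε : (Fin n → ℂ) → ℝ, ContinuousOn ε M → (∀ x ∈ M, 0 < ε x) →
  ∃ g : (Fin n → ℂ) → ℂ, Differentiable ℂ g ∧ ∀ x ∈ M, ‖g x - f x‖ < ε x

/-- The coordinate functions on a closed ball of `ℂ^ι`. -/
def ballCoord {ι : Type*} [Fintype ι] (R : ℝ) (i : ι) :
    C(Metric.closedBall (0 : ι → ℂ) R, ℂ) :=
  ⟨fun w => w.1 i, (continuous_apply i).comp continuous_subtype_val⟩

/-- The closure in `C(closedBall 0 R, ℂ)` of the algebra of polynomial functions. -/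
def polyClosure (ι : Type*) [Fintype ι] (R : ℝ) :
    Subalgebra ℂ C(Metric.closedBall (0 : ι → ℂ) R, ℂ) :=
  (MvPolynomial.aeval (R := ℂ) (ballCoord (ι := ι) R)).range.topologicalClosure

instance (ι : Type*) [Fintype ι] (R : ℝ) : CompleteSpace (polyClosure ι R) :=
  (Subalgebra.isClosed_topologicalClosure _).completeSpace_coe

theorem ballCoord_mem_polyClosure {ι : Type*} [Fintype ι] {R : ℝ} (i : ι) :
    ballCoord R i ∈ polyClosure ι R :=
  Subalgebra.le_topologicalClosure _ ⟨MvPolynomial.X i, by simp⟩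

theorem aeval_ballCoord_apply {ι : Type*} [Fintype ι] {R : ℝ} (p : MvPolynomial ι ℂ)
    (w : Metric.closedBall (0 : ι → ℂ) R) :
    MvPolynomial.aeval (ballCoord R) p w = MvPolynomial.eval w.1 p := by
  induction p using MvPolynomial.induction_on with
  | C a => simp
  | add p q hp hq => simp [hp, hq]
  | mul_X p i hp => simp [hp, ballCoord]

/-- Evaluation at a point of the ball, as a continuous linear functional on `polyClosure`. -/
def evalPolyClosure {ι : Type*} [Fintype ι] {R : ℝ} (w : Metric.closedBall (0 : ι → ℂ) R) :
    polyClosure ι R →L[ℂ] ℂ :=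
  (ContinuousMap.evalCLM ℂ w).comp (polyClosure ι R).toSubmodule.subtypeL

theorem evalPolyClosure_apply {ι : Type*} [Fintype ι] {R : ℝ}
    (w : Metric.closedBall (0 : ι → ℂ) R) (f : polyClosure ι R) :
    evalPolyClosure w f = f.1 w := rfl

theorem mem_polyClosure_of_dependsOn {ι : Type*} [Fintype ι] [DecidableEq ι] {R : ℝ} (hR : 0 ≤ R)
    (s : Finset ι) : ∀ (F : (ι → ℂ) → ℂ) (hF : Differentiable ℂ F),
      (∀ v w : ι → ℂ, (∀ i ∈ s, v i = w i) → F v = F w) →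
      (⟨fun w => F w.1, hF.continuous.comp continuous_subtype_val⟩ :
        C(Metric.closedBall (0 : ι → ℂ) R, ℂ)) ∈ polyClosure ι R := by
  induction s using Finset.induction_on with
  | empty =>
    intro F hF hdep
    convert (polyClosure ι R).algebraMap_mem (F 0) using 1
    ext w
    exact hdep _ _ (by simp)
  | insert i s his ih =>
    intro F hF hdep
    have hFu : ∀ c : ℂ, Differentiable ℂ (fun w => F (Function.update w i c)) := by
      intro c
      refine hF.comp ?_
      rw [differentiable_pi]
      intro j
      by_cases hj : j = i
      · subst hj; simp
      · simp only [Function.update_of_ne hj]; fun_prop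
    have hcont : Continuous
        (fun q : ℂ × Metric.closedBall (0 : ι → ℂ) R => F (Function.update q.2.1 i q.1)) :=
      hF.continuous.comp
        ((continuous_subtype_val.comp continuous_snd).update i continuous_fst)
    let U : ℂ → polyClosure ι R := fun c => ⟨(ContinuousMap.mk _ hcont).curry c,
      ih (fun w => F (Function.update w i c)) (hFu c) (by
        intro v w hvw
        refine hdep _ _ fun j hj => ?_
        by_cases hji : j = i
        · subst hji; simp
        · simpa [Function.update_of_ne hji] using hvw j (Finset.mem_of_mem_insert_of_ne hj hji))⟩
    have hU : Continuous U :=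
      ((ContinuousMap.mk _ hcont).curry.continuous).subtype_mk _
    let x : polyClosure ι R := ⟨_, ballCoord_mem_polyClosure i⟩
    have hx : ‖x‖ ≤ R := by
      change ‖x.1‖ ≤ R
      rw [ContinuousMap.norm_le _ hR]
      intro w
      have h1 := w.2
      rw [mem_closedBall_zero_iff] at h1
      exact (norm_le_pi_norm w.1 i).trans h1
    have hone : ‖(1 : polyClosure ι R)‖ ≤ 1 := by
      change ‖(1 : C(Metric.closedBall (0 : ι → ℂ) R, ℂ))‖ ≤ 1
      rw [ContinuousMap.norm_le _ zero_le_one]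
      simp
    have hunit : ∀ c ∈ Metric.sphere (0 : ℂ) (R + 1),
        IsUnit (algebraMap ℂ (polyClosure ι R) c - x) := by
      intro c hc
      rw [mem_sphere_zero_iff_norm] at hc
      refine spectrum.mem_resolventSet_iff.1 (spectrum.mem_resolventSet_of_norm_lt_mul ?_)
      rw [hc]
      nlinarith [norm_nonneg x, norm_nonneg (1 : polyClosure ι R)]
    let D : ℂ → polyClosure ι R := fun c => Ring.inverse (algebraMap ℂ (polyClosure ι R) c - x)
    have hD : ContinuousOn D (Metric.sphere (0 : ℂ) (R + 1)) := by
      intro c hc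
      obtain ⟨u, hu⟩ := hunit c hc
      have h1 : ContinuousAt Ring.inverse (algebraMap ℂ (polyClosure ι R) c - x) :=
        hu ▸ NormedRing.inverse_continuousAt u
      have h2 : ContinuousAt (fun c => algebraMap ℂ (polyClosure ι R) c - x) c := by
        fun_prop
      exact (ContinuousAt.comp (f := fun c => algebraMap ℂ (polyClosure ι R) c - x) h1 h2).continuousWithinAt
    have hint : CircleIntegrable (fun c => D c * U c) 0 (R + 1) :=
      (hD.mul hU.continuousOn).circleIntegrable (by linarith)
    let G : polyClosure ι R := ∮ c in C(0, R + 1), D c * U c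
    have hG : ∀ w : Metric.closedBall (0 : ι → ℂ) R,
        G.1 w = (2 * Real.pi * Complex.I : ℂ) * F w.1 := by
      intro w
      have hw : w.1 i ∈ Metric.ball (0 : ℂ) (R + 1) := by
        have h1 := w.2
        rw [mem_closedBall_zero_iff] at h1
        rw [mem_ball_zero_iff]
        linarith [norm_le_pi_norm w.1 i]
      have hcomm : evalPolyClosure w G = ∮ c in C(0, R + 1), evalPolyClosure w (D c * U c) := by
        simp only [G, circleIntegral]
        rw [← ContinuousLinearMap.intervalIntegral_comp_comm _ hint.out]
        simp
      rw [← evalPolyClosure_apply, hcomm]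
      have hcongr : ∀ c ∈ Metric.sphere (0 : ℂ) (R + 1), evalPolyClosure w (D c * U c)
          = (c - w.1 i)⁻¹ • F (Function.update w.1 i c) := by
        intro c hc
        have h1 : D c * (algebraMap ℂ (polyClosure ι R) c - x) = 1 :=
          Ring.inverse_mul_cancel _ (hunit c hc)
        have h2 : (D c).1 w * (c - w.1 i) = 1 :=
          congrArg (fun g : polyClosure ι R => g.1 w) h1
        change (D c).1 w * F (Function.update w.1 i c) = _
        rw [eq_inv_of_mul_eq_one_left h2, smul_eq_mul]
      rw [circleIntegral.integral_congr (by linarith) hcongr]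
      have hd : Differentiable ℂ (fun c => F (Function.update w.1 i c)) := by
        refine hF.comp ?_
        rw [differentiable_pi]
        intro j
        by_cases hj : j = i
        · subst hj; simp
        · simp [Function.update_of_ne hj]
      have := hd.differentiableOn.circleIntegral_sub_inv_smul hw
      rw [this]
      simp
    convert (polyClosure ι R).smul_mem G.2 ((2 * Real.pi * Complex.I : ℂ)⁻¹) using 1
    ext w
    simp only [ContinuousMap.coe_mk, ContinuousMap.coe_smul, Pi.smul_apply, hG, smul_eq_mul]
    rw [inv_mul_cancel_left₀ Complex.two_pi_I_ne_zero]

/-- Entire functions are uniformly approximated by polynomials on balls. -/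
theorem exists_mvPolynomial_near_of_differentiable {ι : Type*} [Fintype ι]
    {F : (ι → ℂ) → ℂ} (hF : Differentiable ℂ F) (R : ℝ) {ε : ℝ} (hε : 0 < ε) :
    ∃ p : MvPolynomial ι ℂ, ∀ w : ι → ℂ, ‖w‖ ≤ R → ‖MvPolynomial.eval w p - F w‖ < ε := by
  classical
  rcases lt_or_ge R 0 with hR | hR
  · exact ⟨0, fun w hw => absurd (hw.trans_lt hR) (norm_nonneg w).not_gt⟩
  have h := mem_polyClosure_of_dependsOn hR Finset.univ F hF
    (fun v w hvw => congrArg F (funext fun i => hvw i (Finset.mem_univ i)))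
  obtain ⟨g, ⟨p, rfl⟩, hp⟩ := Metric.mem_closure_iff.1 h ε hε
  refine ⟨p, fun w hw => ?_⟩
  have h1 := (ContinuousMap.dist_apply_le_dist ⟨w, mem_closedBall_zero_iff.2 hw⟩).trans_lt hp
  rw [dist_comm, dist_eq_norm] at h1
  have h2 := aeval_ballCoord_apply p ⟨w, mem_closedBall_zero_iff.2 hw⟩
  rw [← h2]
  exact h1

theorem exists_entire_correction {a : ℕ → ℂ} (ha : Function.Injective a) (ha0 : ∀ k, a k ≠ 0)
    (k : ℕ) (c : ℂ) :
    ∃ T : ℂ → ℂ, Differentiable ℂ T ∧ (∀ j < k, T (a j) = 0) ∧ T (a k) = c ∧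
      ∀ w : ℂ, ‖w‖ ≤ ‖a k‖ / 2 → ‖T w‖ ≤ (1 / 2 : ℝ) ^ k := by
  let N : ℂ → ℂ := fun w => ∏ j ∈ Finset.range k, (w - a j)
  have hN : Differentiable ℂ N := by fun_prop
  have hNk : N (a k) ≠ 0 := Finset.prod_ne_zero_iff.2 fun j hj =>
    sub_ne_zero.2 fun h => (Finset.mem_range.1 hj).ne' (ha h)
  obtain ⟨C, hC⟩ := (isCompact_closedBall (0 : ℂ) (‖a k‖ / 2)).exists_bound_of_continuousOn
    (f := fun w => c / N (a k) * N w) (by fun_prop)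
  have hC1 : 0 < |C| + 1 := by positivity
  obtain ⟨m, hm⟩ := exists_pow_lt_of_lt_one (show 0 < (1 / 2 : ℝ) ^ k / (|C| + 1) by positivity)
    (show (1 / 2 : ℝ) < 1 by norm_num)
  rw [lt_div_iff₀ hC1] at hm
  refine ⟨fun w => c / N (a k) * N w * (w / a k) ^ m, by fun_prop, fun j hj => ?_, ?_, ?_⟩
  · have : N (a j) = 0 := Finset.prod_eq_zero (Finset.mem_range.2 hj) (sub_self _)
    simp [this]
  · simp [div_self (ha0 k), div_mul_cancel₀ _ hNk]
  · intro w hw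
    have h1 := hC w (mem_closedBall_zero_iff.2 hw)
    have h2 : ‖w / a k‖ ≤ 1 / 2 := by
      rw [norm_div, div_le_iff₀ (norm_pos_iff.2 (ha0 k))]
      linarith
    rw [norm_mul, norm_pow]
    calc _ ≤ (|C| + 1) * (1 / 2 : ℝ) ^ m := by
          gcongr
          linarith [le_abs_self C]
      _ ≤ _ := by rw [mul_comm]; exact hm.le

theorem exists_entire_interpolation {a : ℕ → ℂ} (ha : Function.Injective a)
    (hlarge : ∀ k, (2 : ℝ) ^ k ≤ ‖a k‖) (b : ℕ → ℂ) :
    ∃ q : ℂ → ℂ, Differentiable ℂ q ∧ ∀ k, q (a k) = b k := by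
  have ha0 : ∀ k, a k ≠ 0 := fun k => norm_pos_iff.1 (lt_of_lt_of_le (by positivity) (hlarge k))
  choose T hTd hT0 hTk hTs using exists_entire_correction ha ha0
  let S : ℕ → ℂ → ℂ := fun k => Nat.rec (fun _ => 0) (fun j s w => s w + T j (b j - s (a j)) w) k
  let t : ℕ → ℂ → ℂ := fun k => T k (b k - S k (a k))
  have hS : ∀ k w, S k w = ∑ j ∈ Finset.range k, t j w := by
    intro k w
    induction k with
    | zero => simp [S]
    | succ k ih => rw [Finset.sum_range_succ, ← ih]
  refine ⟨fun w => ∑' k, t k w, fun w₀ => ?_, fun k => ?_⟩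
  · obtain ⟨K, hK⟩ := pow_unbounded_of_one_lt (2 * (‖w₀‖ + 1)) (one_lt_two (α := ℝ))
    have hu := tendstoUniformlyOn_tsum_nat_eventually (f := t) (s := Metric.ball 0 (‖w₀‖ + 1))
      (summable_geometric_of_lt_one (r := (1 / 2 : ℝ)) (by norm_num) (by norm_num)) (by
        filter_upwards [Filter.eventually_ge_atTop K] with k hk w hw
        refine hTs k _ w ?_
        have h1 : (2 : ℝ) ^ K ≤ 2 ^ k := pow_le_pow_right₀ one_le_two hk
        rw [mem_ball_zero_iff] at hw
        linarith [hlarge k])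
    have hd := hu.tendstoLocallyUniformlyOn.differentiableOn
      (Filter.Eventually.of_forall fun N =>
        (Differentiable.fun_sum fun k _ => hTd k _).differentiableOn) Metric.isOpen_ball
    exact hd.differentiableAt (Metric.isOpen_ball.mem_nhds (by simp))
  · change ∑' j, t j (a k) = b k
    rw [tsum_eq_sum (s := Finset.range (k + 1)) fun j hj => hT0 j _ k (by simpa using hj),
      Finset.sum_range_succ, ← hS]
    simp [hTk]

theorem exists_entire_zeros_eq_range {a : ℕ → ℂ} (hlarge : ∀ k, (2 : ℝ) ^ k ≤ ‖a k‖) :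
    ∃ P : ℂ → ℂ, Differentiable ℂ P ∧ ∀ w, P w = 0 ↔ w ∈ range a := by
  have ha0 : ∀ k, a k ≠ 0 := fun k => norm_pos_iff.1 (lt_of_lt_of_le (by positivity) (hlarge k))
  have hbound : ∀ (w : ℂ) (R : ℝ), ‖w‖ ≤ R → ∀ k, ‖-(w / a k)‖ ≤ R * (1 / 2 : ℝ) ^ k := by
    intro w R hw k
    rw [norm_neg, norm_div, div_le_iff₀ (norm_pos_iff.2 (ha0 k))]
    have h1 : (1 / 2 : ℝ) ^ k * 2 ^ k = 1 := by rw [← mul_pow]; norm_num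
    have h2 : 1 ≤ (1 / 2 : ℝ) ^ k * ‖a k‖ := by
      calc (1 : ℝ) = (1 / 2 : ℝ) ^ k * 2 ^ k := h1.symm
        _ ≤ _ := by
          gcongr
          exact hlarge k
    nlinarith [norm_nonneg w]
  have hsum : ∀ R : ℝ, Summable fun k : ℕ => R * (1 / 2 : ℝ) ^ k := fun R =>
    (summable_geometric_of_lt_one (by norm_num) (by norm_num)).mul_left R
  refine ⟨fun w => ∏' k, (1 + -(w / a k)), fun w₀ => ?_, fun w => ⟨fun h => ?_, ?_⟩⟩
  · have hu := Summable.hasProdLocallyUniformlyOn_nat_one_add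
      (f := fun k w => -(w / a k)) (K := Metric.ball (0 : ℂ) (‖w₀‖ + 1)) Metric.isOpen_ball
      (hsum (‖w₀‖ + 1))
      (Filter.Eventually.of_forall fun k w hw => hbound w _ (mem_ball_zero_iff.1 hw).le k)
      (fun k => by fun_prop)
    rw [hasProdLocallyUniformlyOn_iff_tendstoLocallyUniformlyOn] at hu
    have hd := hu.differentiableOn
      (Filter.Eventually.of_forall fun N => by fun_prop) Metric.isOpen_ball
    exact hd.differentiableAt (Metric.isOpen_ball.mem_nhds (by simp))
  · by_contra hw
    refine tprod_one_add_ne_zero_of_summable (f := fun k => -(w / a k)) (fun k hk => hw ⟨k, ?_⟩)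
      ((hsum ‖w‖).of_nonneg_of_le (fun _ => norm_nonneg _) (hbound w _ le_rfl)) h
    have h1 : w / a k = 1 := by linear_combination -hk
    exact ((div_eq_one_iff_eq (ha0 k)).1 h1).symm
  · rintro ⟨k, rfl⟩
    exact tprod_of_exists_eq_zero ⟨k, by simp [div_self (ha0 k)]⟩

theorem exists_seq_of_not_isBounded {n : ℕ} {s : Set (Fin n → ℂ)} (hs : ¬ Bornology.IsBounded s) :
    ∃ (i : Fin n) (z : ℕ → Fin n → ℂ), (∀ k, z k ∈ s) ∧ (∀ k, (2 : ℝ) ^ k ≤ ‖z k i‖) ∧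
      Function.Injective fun k => z k i := by
  rw [← Bornology.forall_isBounded_image_eval_iff] at hs
  push Not at hs
  obtain ⟨i, hi⟩ := hs
  have hex : ∀ r : ℝ, ∃ z ∈ s, r < ‖z i‖ := by
    intro r
    by_contra! h
    exact hi ((isBounded_iff_forall_norm_le).2 ⟨r, by rintro _ ⟨z, hz, rfl⟩; exact h z hz⟩)
  choose f hfs hf using hex
  let z : ℕ → Fin n → ℂ := fun k => Nat.rec (f 1) (fun _ y => f (2 * ‖y i‖)) k
  have hstep : ∀ k, 2 * ‖z k i‖ < ‖z (k + 1) i‖ := fun k => hf _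
  have hlarge : ∀ k, (2 : ℝ) ^ k ≤ ‖z k i‖ := by
    intro k
    induction k with
    | zero => exact (pow_zero (2 : ℝ)).trans_le (hf 1).le
    | succ k ih => rw [pow_succ]; linarith [hstep k]
  have hmono : StrictMono fun k => ‖z k i‖ :=
    strictMono_nat_of_lt_succ fun k => by linarith [hstep k, norm_nonneg (z k i)]
  refine ⟨i, z, fun k => ?_, hlarge, fun k l h => hmono.injective (congrArg norm h)⟩
  cases k <;> exact hfs _

theorem norm_le_of_mem_polyHull {n : ℕ} {X : Set (Fin n → ℂ)} {F : (Fin n → ℂ) → ℂ}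
    (hF : Differentiable ℂ F) {B : ℝ} (hB : 0 ≤ B) (hX : ∀ x ∈ X, ‖F x‖ ≤ B) {z : Fin n → ℂ}
    (hz : z ∈ polyHull X) : ‖F z‖ ≤ B := by
  simp only [polyHull, mem_iUnion, mem_ofPred_eq] at hz
  obtain ⟨C, ⟨hC, hCX⟩, hzC⟩ := hz
  obtain ⟨R, hR⟩ := hC.isBounded.exists_norm_le
  refine le_of_forall_pos_le_add fun ε hε => ?_
  obtain ⟨p, hp⟩ := exists_mvPolynomial_near_of_differentiable hF (max R ‖z‖) (half_pos hε)
  have h1 : sSup ((fun w => ‖MvPolynomial.eval w p‖) '' C) ≤ B + ε / 2 := by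
    refine Real.sSup_le ?_ (by positivity)
    rintro _ ⟨w, hw, rfl⟩
    have h2 := hp w ((hR w hw).trans (le_max_left _ _))
    have h3 := norm_le_norm_add_norm_sub' (MvPolynomial.eval w p) (F w)
    have h4 := hX w (hCX hw)
    change ‖MvPolynomial.eval w p‖ ≤ _
    linarith
  have h2 := hp z (le_max_right _ _)
  have h3 := norm_le_norm_add_norm_sub (MvPolynomial.eval z p) (F z)
  have h4 := hzC p
  linarith

/-- On a Carleman set, finitely many entire functions without common zeros on the set generate an
entire function that is as small as desired there and equals `1` on the common zero set. -/
theorem IsCarleman.exists_entire_eq_one_on_zeros {n : ℕ} {M : Set (Fin n → ℂ)} (hM : IsCarleman M)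
    {ι : Type*} [Fintype ι] {P : ι → (Fin n → ℂ) → ℂ} (hP : ∀ i, Differentiable ℂ (P i))
    (hzero : ∀ w ∈ M, ∃ i, P i w ≠ 0) {δ : (Fin n → ℂ) → ℝ} (hδ : ContinuousOn δ M)
    (hδpos : ∀ w ∈ M, 0 < δ w) :
    ∃ h : (Fin n → ℂ) → ℂ, Differentiable ℂ h ∧ (∀ w, (∀ i, P i w = 0) → h w = 1) ∧
      ∀ w ∈ M, ‖h w‖ ≤ δ w := by
  have hPc : ∀ i, Continuous (P i) := fun i => (hP i).continuous
  let σ : (Fin n → ℂ) → ℂ := fun w => ∑ i, P i w * (starRingEnd ℂ) (P i w)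
  have hσc : Continuous σ := by
    exact continuous_finsetSum _ fun i _ => (hPc i).mul (Complex.continuous_conj.comp (hPc i))
  have hσ : ∀ w ∈ M, σ w ≠ 0 := by
    intro w hw h0
    obtain ⟨i, hi⟩ := hzero w hw
    have h1 : σ w = ((∑ i, Complex.normSq (P i w) : ℝ) : ℂ) := by
      simp [σ, Complex.mul_conj]
    rw [h1, Complex.ofReal_eq_zero,
      Finset.sum_eq_zero_iff_of_nonneg fun _ _ => Complex.normSq_nonneg _] at h0
    exact hi (Complex.normSq_eq_zero.1 (h0 i (Finset.mem_univ i)))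
  let τ : (Fin n → ℂ) → ℝ := fun w => 1 + ∑ i, ‖P i w‖
  have hτpos : ∀ w, 0 < τ w := fun w => by positivity
  have hτc : Continuous τ := by fun_prop
  have happrox : ∀ i, ∃ g : (Fin n → ℂ) → ℂ, Differentiable ℂ g ∧
      ∀ w ∈ M, ‖g w - (starRingEnd ℂ) (P i w) / σ w‖ < δ w / τ w := fun i =>
    hM _ ((Complex.continuous_conj.comp (hPc i)).continuousOn.div hσc.continuousOn hσ) _
      (hδ.div hτc.continuousOn fun w _ => (hτpos w).ne') fun w hw => div_pos (hδpos w hw) (hτpos w)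
  choose g hg hgM using happrox
  refine ⟨fun w => 1 - ∑ i, g i w * P i w, ?_, fun w hw => by simp [hw], fun w hw => ?_⟩
  · exact (differentiable_const _).sub (Differentiable.fun_sum fun i _ => (hg i).mul (hP i))
  · have h1 : 1 - ∑ i, g i w * P i w
        = -∑ i, (g i w - (starRingEnd ℂ) (P i w) / σ w) * P i w := by
      have h2 : ∑ i, (starRingEnd ℂ) (P i w) / σ w * P i w = 1 := by
        rw [← div_self (hσ w hw)]
        nth_rewrite 3 [show σ = fun w => ∑ i, P i w * (starRingEnd ℂ) (P i w) from rfl]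
        rw [Finset.sum_div]
        exact Finset.sum_congr rfl fun i _ => by ring
      simp only [sub_mul, Finset.sum_sub_distrib, h2]
      ring
    change ‖1 - ∑ i, g i w * P i w‖ ≤ δ w
    rw [h1, norm_neg]
    calc _ ≤ ∑ i, ‖(g i w - (starRingEnd ℂ) (P i w) / σ w) * P i w‖ := norm_sum_le _ _
      _ ≤ ∑ i, δ w / τ w * ‖P i w‖ := by
          gcongr with i
          rw [norm_mul]
          gcongr
          exact (hgM i w hw).le
      _ = δ w / τ w * ∑ i, ‖P i w‖ := by rw [Finset.mul_sum]
      _ ≤ δ w / τ w * τ w := by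
          gcongr
          · exact (div_pos (hδpos w hw) (hτpos w)).le
          · simp [τ]
      _ = δ w := div_mul_cancel₀ _ (hτpos w).ne'

/-- A closed Carleman continuum in ℂⁿ has bounded E-hulls. -/
theorem carleman_implies_boundedEHulls {n : ℕ} (M : Set (Fin n → ℂ))
    (hMclosed : IsClosed M) (hMcar : IsCarleman M) :
    HasBoundedEHulls M := by
  intro K hK
  by_contra hunb
  obtain ⟨i₀, z, hz, hlarge, hinj⟩ := exists_seq_of_not_isBounded hunb
  obtain ⟨P, hP, hPzero⟩ := exists_entire_zeros_eq_range hlarge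
  choose q hq hqz using fun i => exists_entire_interpolation hinj hlarge fun k => z k i
  let Q : Option (Fin n) → (Fin n → ℂ) → ℂ := fun o =>
    o.elim (fun w => P (w i₀)) fun i w => w i - q i (w i₀)
  have hQ : ∀ o, Differentiable ℂ (Q o) := by
    have h0 : Differentiable ℂ fun w : Fin n → ℂ => w i₀ := by fun_prop
    rintro (_ | i)
    · exact hP.comp h0
    · exact Differentiable.sub (by fun_prop) ((hq i).comp h0)
  have hQz : ∀ k o, Q o (z k) = 0 := by
    rintro k (_ | i)
    · exact (hPzero _).2 ⟨k, rfl⟩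
    · exact sub_eq_zero.2 (hqz i k).symm
  have hQM : ∀ w ∈ M, ∃ o, Q o w ≠ 0 := by
    intro w hw
    by_contra! h
    obtain ⟨k, hk⟩ := (hPzero (w i₀)).1 (h none)
    have hwz : w = z k := by
      funext i
      have h1 : w i - q i (w i₀) = 0 := h (some i)
      rw [sub_eq_zero.1 h1, ← hk, hqz]
    exact (hz k).2 (Or.inr (hwz ▸ hw))
  obtain ⟨h, hh, hone, hsmall⟩ := hMcar.exists_entire_eq_one_on_zeros hQ hQM
    (δ := fun w => (1 + ‖w i₀‖)⁻¹)
    (Continuous.continuousOn (Continuous.inv₀ (by fun_prop) fun w => by positivity))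
    (fun w _ => by positivity)
  have hF : Differentiable ℂ fun w => h w * w i₀ := hh.mul (by fun_prop)
  obtain ⟨B, hB⟩ := hK.exists_bound_of_continuousOn hF.continuous.continuousOn
  have hbound : ∀ k, ‖z k i₀‖ ≤ max B 1 := by
    intro k
    have h1 := norm_le_of_mem_polyHull hF (zero_le_one.trans (le_max_right B 1)) (by
      rintro w (hw | hw)
      · exact (hB w hw).trans (le_max_left _ _)
      · refine le_trans ?_ (le_max_right _ _)
        rw [norm_mul]
        calc _ ≤ (1 + ‖w i₀‖)⁻¹ * (1 + ‖w i₀‖) := by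
              gcongr
              · exact hsmall w hw
              · linarith
          _ = 1 := inv_mul_cancel₀ (by positivity)) (hz k).1
    simpa [hone _ (hQz k)] using h1
  obtain ⟨k, hk⟩ := pow_unbounded_of_one_lt (max B 1) (one_lt_two (α := ℝ))
  exact ((hlarge k).trans (hbound k)).not_gt hk
end
end

section
/- Let x : ℕ → ℂⁿ be an injective sequence whose image E = {x_j : j ∈ ℕ} is a closed discrete subset of ℂⁿ (i.e., E has no accumulation point in ℂⁿ). Then there exist entire functions f₁, …, f_n on ℂⁿ whose common zero set Z(f₁,…,f_n) = {z ∈ ℂⁿ : f₁(z) = ⋯ = f_n(z) = 0} is exactly E. -/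
open Set

noncomputable section

open Filter Topology

section Limits

variable {E G : Type*} [NormedAddCommGroup E] [NormedSpace ℂ E]
  [NormedAddCommGroup G] [NormedSpace ℂ G]

/-- Cauchy's estimate on a unit ball. -/
lemma norm_fderiv_le_of_norm_le_on_closedBall {f : E → G} (hf : Differentiable ℂ f) {z : E} {C : ℝ}
    (hC : ∀ w, ‖w - z‖ ≤ 1 → ‖f w‖ ≤ C) : ‖fderiv ℂ f z‖ ≤ C := by
  have hC0 : 0 ≤ C := (norm_nonneg _).trans (hC z (by simp))
  refine ContinuousLinearMap.opNorm_le_bound _ hC0 fun v => ?_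
  rcases eq_or_ne v 0 with rfl | hv
  · simp
  have hv' : 0 < ‖v‖ := norm_pos_iff.2 hv
  have hline : HasDerivAt (fun t : ℂ => z + t • v) v 0 := by
    simpa using ((hasDerivAt_id (0 : ℂ)).smul_const v).const_add z
  have hderiv : HasDerivAt (fun t : ℂ => f (z + t • v)) (fderiv ℂ f z v) 0 := by
    refine HasFDerivAt.comp_hasDerivAt (0 : ℂ) ?_ hline
    simpa using (hf z).hasFDerivAt
  have hdiff : Differentiable ℂ (fun t : ℂ => f (z + t • v)) :=
    hf.comp ((differentiable_id.smul_const v).const_add z)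
  have := Complex.norm_deriv_le_of_forall_mem_sphere_norm_le (c := 0) (R := ‖v‖⁻¹)
    (C := C) (inv_pos.2 hv') hdiff.diffContOnCl (fun t ht => hC _ (by
      have : ‖t‖ = ‖v‖⁻¹ := by simpa using ht
      simp [norm_smul, this, hv'.ne']))
  rw [hderiv.deriv] at this
  simpa [div_eq_mul_inv] using this

/-- A sequence of entire maps whose increments are summably small on exhausting balls has an
entire limit. -/
lemma exists_entire_limit [CompleteSpace G] {F : ℕ → E → G} (hF : ∀ k, Differentiable ℂ (F k))
    {r : ℕ → ℝ} (hr : Tendsto r atTop atTop)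
    (hd : ∀ k z, ‖z‖ ≤ r k → ‖F (k + 1) z - F k z‖ ≤ (1 / 2) ^ k) :
    ∃ f : E → G, Differentiable ℂ f ∧ ∀ z, Tendsto (fun k => F k z) atTop (𝓝 (f z)) := by
  have key : ∀ R : ℝ, 0 < R → ∃ g : E → G, ∀ z, ‖z‖ < R →
      DifferentiableAt ℂ g z ∧ Tendsto (fun k => F k z) atTop (𝓝 (g z)) := by
    intro R hR
    obtain ⟨K, hK⟩ := eventually_atTop.1 (hr.eventually_ge_atTop (R + 1))
    let d : ℕ → E → G := fun k z => F (K + k + 1) z - F (K + k) z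
    have hdd : ∀ k, Differentiable ℂ (d k) := fun k => (hF _).sub (hF _)
    have hdb : ∀ k z, ‖z‖ ≤ R + 1 → ‖d k z‖ ≤ (1 / 2 : ℝ) ^ k := fun k z hz =>
      (hd (K + k) z (hz.trans (hK _ (by omega)))).trans
        (pow_le_pow_of_le_one (by norm_num) (by norm_num) (by omega))
    have hu : Summable fun k : ℕ => (1 / 2 : ℝ) ^ k := summable_geometric_two
    have hsum : ∀ z, ‖z‖ < R → Summable fun k => d k z := fun z hz =>
      Summable.of_norm_bounded hu fun k => hdb k z (by linarith)
    refine ⟨fun z => F K z + ∑' k, d k z, fun z hz => ⟨?_, ?_⟩⟩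
    · refine (hF K z).add (HasFDerivAt.differentiableAt
        (hasFDerivAt_tsum_of_isPreconnected (s := Metric.ball (0 : E) R)
        (f' := fun k z => fderiv ℂ (d k) z) (x₀ := 0) hu Metric.isOpen_ball
        ((convex_ball (0 : E) R).isPreconnected) (fun k y _ => (hdd k y).hasFDerivAt)
        (fun k y hy => norm_fderiv_le_of_norm_le_on_closedBall (hdd k) fun w hw => hdb k w ?_)
        (by simpa using hR) (hsum 0 (by simpa using hR)) (by simpa using hz)))
      have hy' : ‖y‖ < R := by simpa using hy
      have := norm_add_le (w - y) y
      rw [sub_add_cancel] at this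
      linarith
    · have h1 := (hsum z hz).hasSum.tendsto_sum_nat.const_add (F K z)
      have h2 : ∀ n, F K z + ∑ i ∈ Finset.range n, d i z = F (n + K) z := by
        intro n
        have := Finset.sum_range_sub (fun i => F (K + i) z) n
        simp only [d, add_assoc] at *
        rw [this]
        simp [add_comm K n]
      simp only [h2] at h1
      exact (tendsto_add_atTop_iff_nat K).1 h1
  have hlim : ∀ z, ∃ y, Tendsto (fun k => F k z) atTop (𝓝 y) := fun z => by
    obtain ⟨g, hg⟩ := key (‖z‖ + 1) (by positivity)
    exact ⟨g z, (hg z (by linarith)).2⟩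
  choose f hf using hlim
  refine ⟨f, fun z => ?_, hf⟩
  obtain ⟨g, hg⟩ := key (‖z‖ + 1) (by positivity)
  refine (hg z (by linarith)).1.congr_of_eventuallyEq ?_
  filter_upwards [(isOpen_lt continuous_norm continuous_const).mem_nhds
    (show ‖z‖ < ‖z‖ + 1 by linarith)] with y hy
  exact tendsto_nhds_unique (hf y) (hg y hy).2

/-- If zeros can be added one at a time by arbitrarily small modifications on balls, then every
sequence tending to infinity is the zero set of an entire map. -/
lemma exists_entire_zeroSet_eq_range [ProperSpace E] [CompleteSpace G] (P : (E → G) → Prop)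
    (hP : ∀ F, P F → Differentiable ℂ F)
    (hinit : ∃ F, P F ∧ ∀ z, F z ≠ 0)
    (hstep : ∀ F, P F → ∀ S : Set E, S.Finite → (∀ z, F z = 0 ↔ z ∈ S) → ∀ p, p ∉ S → p ≠ 0 →
      ∀ ε : ℝ, 0 < ε → ∃ F', P F' ∧ (∀ z, F' z = 0 ↔ z = p ∨ z ∈ S) ∧
        ∀ z, ‖z‖ ≤ ‖p‖ / 2 → ‖F' z - F z‖ ≤ ε)
    (x : ℕ → E) (hinj : Function.Injective x) (h0 : ∀ k, x k ≠ 0)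
    (hx : Tendsto (fun k => ‖x k‖) atTop atTop) :
    ∃ f : E → G, Differentiable ℂ f ∧ {z | f z = 0} = range x := by
  let c : ℕ → ℝ := fun k => 1 + (1 / 2) ^ k
  have hc : ∀ k, c (k + 1) < c k := fun k => by
    have : (0 : ℝ) < (1 / 2) ^ k := by positivity
    simp only [c, pow_succ]; linarith
  have hc1 : ∀ k, 1 ≤ c k := fun k => by
    have : (0 : ℝ) < (1 / 2) ^ k := by positivity
    simp only [c]; linarith
  have hc2 : ∀ k, c k ≤ 2 := fun k => by
    have : ((1 : ℝ) / 2) ^ k ≤ 1 := pow_le_one₀ (by norm_num) (by norm_num)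
    simp only [c]; linarith
  let A : ℕ → Set E := fun k => {z | ‖z‖ ≤ ‖x k‖ / 2 ∧ ∀ j < k, (k + 1 : ℝ)⁻¹ ≤ ‖z - x j‖}
  have hA : ∀ k, IsCompact (A k) := fun k => by
    refine (isCompact_closedBall (0 : E) (‖x k‖ / 2)).of_isClosed_subset ?_
      (fun z hz => by simpa using hz.1)
    refine (isClosed_le continuous_norm continuous_const).inter ?_
    have h : {z : E | ∀ j < k, (k + 1 : ℝ)⁻¹ ≤ ‖z - x j‖} =
        ⋂ j, ⋂ (_ : j < k), {z : E | (k + 1 : ℝ)⁻¹ ≤ ‖z - x j‖} := by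
      ext; simp
    change IsClosed {z : E | ∀ j < k, (k + 1 : ℝ)⁻¹ ≤ ‖z - x j‖}
    rw [h]
    exact isClosed_iInter fun j => isClosed_iInter fun _ =>
      isClosed_le continuous_const (by fun_prop)
  let Good : ℕ → (E → G) → Prop := fun k F => P F ∧ ∀ z, F z = 0 ↔ z ∈ x '' Iio k
  have step : ∀ k F, Good k F → ∃ F', Good (k + 1) F' ∧
      (∀ z, ‖z‖ ≤ ‖x k‖ / 2 → ‖F' z - F z‖ ≤ (1 / 2) ^ k) ∧
      ∀ z ∈ A k, c (k + 1) * ‖F z‖ ≤ c k * ‖F' z‖ := by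
    rintro k F ⟨hF, hz⟩
    obtain ⟨m, hm, hmA⟩ : ∃ m : ℝ, 0 < m ∧ ∀ z ∈ A k, m ≤ ‖F z‖ := by
      obtain ⟨m, hm, hmA⟩ := (hA k).exists_forall_le' (f := fun z => ‖F z‖)
        ((hP F hF).continuous.norm.continuousOn) (a := 0) (fun z hzA => by
          refine norm_pos_iff.2 fun h => ?_
          obtain ⟨j, hj, rfl⟩ := (hz z).1 h
          have := hzA.2 j hj
          simp only [sub_self, norm_zero] at this
          exact absurd this (not_le.2 (by positivity)))
      exact ⟨m, hm, hmA⟩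
    obtain ⟨F', hF', hz', hd⟩ := hstep F hF (x '' Iio k) ((finite_Iio k).image x) hz (x k)
      (by rintro ⟨j, hj, hjk⟩; exact (ne_of_lt hj) (hinj hjk)) (h0 k)
      (min ((1 / 2) ^ k) ((c k - c (k + 1)) * m / 2))
      (lt_min (by positivity) (by have := sub_pos.2 (hc k); positivity))
    refine ⟨F', ⟨hF', fun z => ?_⟩, fun z hz => (hd z hz).trans (min_le_left _ _), fun z hzA => ?_⟩
    · rw [hz', show Iio (k + 1) = insert k (Iio k) by ext j; simp, image_insert_eq,
        mem_insert_iff]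
    · have h1 := (hd z hzA.1).trans (min_le_right _ _)
      have h2 := hmA z hzA
      have h3 : ‖F z‖ - ‖F' z‖ ≤ ‖F' z - F z‖ := by
        rw [norm_sub_rev]; exact norm_sub_norm_le _ _
      have h4 := hc k
      have h5 := hc2 k
      have h6 := hc1 k
      have h7 : c k * (‖F z‖ - ‖F' z‖) ≤ c k * ((c k - c (k + 1)) * m / 2) :=
        mul_le_mul_of_nonneg_left (h3.trans h1) (by linarith)
      have h8 : c k * ((c k - c (k + 1)) * m / 2) ≤ (c k - c (k + 1)) * m := by
        have : 0 ≤ (c k - c (k + 1)) * m := mul_nonneg (by linarith) hm.le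
        nlinarith
      have h9 : (c k - c (k + 1)) * m ≤ (c k - c (k + 1)) * ‖F z‖ :=
        mul_le_mul_of_nonneg_left h2 (by linarith)
      linarith
  obtain ⟨F₀, hF₀, hF₀z⟩ := hinit
  choose! next hnext using step
  let F : ℕ → E → G := fun k => Nat.rec F₀ (fun k F => next k F) k
  have hGood : ∀ k, Good k (F k) := by
    intro k
    induction k with
    | zero => exact ⟨hF₀, fun z => by simp [F, hF₀z]⟩
    | succ k ih => exact (hnext k (F k) ih).1
  have hnear : ∀ k z, ‖z‖ ≤ ‖x k‖ / 2 → ‖F (k + 1) z - F k z‖ ≤ (1 / 2) ^ k :=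
    fun k => (hnext k (F k) (hGood k)).2.1
  have hlower : ∀ k, ∀ z ∈ A k, c (k + 1) * ‖F k z‖ ≤ c k * ‖F (k + 1) z‖ :=
    fun k => (hnext k (F k) (hGood k)).2.2
  have hr : Tendsto (fun k => ‖x k‖ / 2) atTop atTop := hx.atTop_div_const (by norm_num)
  obtain ⟨f, hf, hlim⟩ := exists_entire_limit (fun k => hP _ (hGood k).1) hr hnear
  refine ⟨f, hf, ?_⟩
  ext z
  constructor
  · intro hfz
    by_contra hzx
    have hclosed : IsClosed (range x) :=
      (Topology.IsClosedEmbedding.of_continuous_injective_isClosedMap (f := x)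
        continuous_of_discreteTopology hinj (by
          have : Tendsto x (cocompact ℕ) (cocompact E) := by
            rw [cocompact_eq_cofinite, Nat.cofinite_eq_atTop]
            exact tendsto_norm_atTop_iff_cobounded.1 hx |>.mono_right (by
              rw [Metric.cobounded_eq_cocompact])
          exact (isProperMap_iff_tendsto_cocompact.2
            ⟨continuous_of_discreteTopology, this⟩).isClosedMap)).isClosed_range
    obtain ⟨δ, hδ, hball⟩ := Metric.isOpen_iff.1 hclosed.isOpen_compl z hzx
    have hAev : ∀ᶠ k in atTop, z ∈ A k := by
      filter_upwards [hr.eventually_ge_atTop ‖z‖,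
        (tendsto_one_div_add_atTop_nhds_zero_nat (𝕜 := ℝ)).eventually_lt_const hδ] with k h1 h2
      refine ⟨h1, fun j _ => ?_⟩
      by_contra! h
      refine hball (a := x j) ?_ (mem_range_self j)
      rw [Metric.mem_ball, dist_comm, dist_eq_norm]
      rw [one_div] at h2
      exact h.trans h2
    obtain ⟨K, hK⟩ := eventually_atTop.1 hAev
    have hmono : ∀ k ≥ K, ‖F K z‖ / c K ≤ ‖F k z‖ / c k := by
      intro k hk
      induction k, hk using Nat.le_induction with
      | base => exact le_rfl
      | succ k hk ih =>
        refine ih.trans ?_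
        have := hlower k z (hK k hk)
        rw [div_le_div_iff₀ (by linarith [hc1 k]) (by linarith [hc1 (k + 1)])]
        linarith
    have hpos : 0 < ‖F K z‖ / c K := by
      refine div_pos (norm_pos_iff.2 fun h => ?_) (by linarith [hc1 K])
      obtain ⟨j, _, rfl⟩ := ((hGood K).2 z).1 h
      exact hzx (mem_range_self j)
    have : ‖F K z‖ / c K ≤ ‖f z‖ := by
      refine ge_of_tendsto (hlim z).norm (eventually_atTop.2 ⟨K, fun k hk => ?_⟩)
      exact (hmono k hk).trans (div_le_self (norm_nonneg _) (hc1 k))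
    rw [show f z = 0 from hfz, norm_zero] at this
    linarith
  · rintro ⟨j, rfl⟩
    refine tendsto_nhds_unique (hlim (x j)) (tendsto_const_nhds.congr' ?_)
    filter_upwards [eventually_gt_atTop j] with k hk
    exact (((hGood k).2 (x j)).2 ⟨j, hk, rfl⟩).symm

end Limits

/-- An entire function of one variable, small on a disc, with prescribed zeros and value one at a
given point off the disc. -/
lemma exists_entire_small_on_disc {A : Set ℂ} (hA : A.Finite) {a : ℂ} (ha : a ∉ A) {ρ ε : ℝ}
    (hρ : 0 ≤ ρ) (hρa : ρ < ‖a‖) (hε : 0 < ε) :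
    ∃ h : ℂ → ℂ, Differentiable ℂ h ∧ h a = 1 ∧ (∀ s ∈ A, h s = 0) ∧
      ∀ ζ, ‖ζ‖ ≤ ρ → ‖h ζ‖ ≤ ε := by
  have ha0 : 0 < ‖a‖ := hρ.trans_lt hρa
  let g : ℂ → ℂ := fun ζ => ∏ s ∈ hA.toFinset, (ζ - s) / (a - s)
  have hg : Differentiable ℂ g := by fun_prop
  obtain ⟨C, hC⟩ := (isCompact_closedBall (0 : ℂ) ρ).exists_bound_of_continuousOn
    hg.continuous.continuousOn
  have hC' : 0 ≤ C := (norm_nonneg _).trans (hC 0 (by simpa using hρ))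
  have hlim : Tendsto (fun N : ℕ => C * (ρ / ‖a‖) ^ N) atTop (𝓝 (C * 0)) :=
    (tendsto_pow_atTop_nhds_zero_of_lt_one (by positivity)
      ((div_lt_one ha0).2 hρa)).const_mul C
  rw [mul_zero] at hlim
  obtain ⟨N, hN⟩ := (hlim.eventually_lt_const hε).exists
  refine ⟨fun ζ => g ζ * (ζ / a) ^ N, by fun_prop, ?_, fun s hs => ?_, fun ζ hζ => ?_⟩
  · have : g a = 1 := Finset.prod_eq_one fun s hs => div_self <| sub_ne_zero.2 <| by
      rintro rfl; exact ha (by simpa using hs)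
    simp [this, div_self (norm_pos_iff.1 ha0)]
  · have : g s = 0 := Finset.prod_eq_zero (i := s) (by simpa using hs) (by simp)
    simp [this]
  · rw [norm_mul, norm_pow, norm_div]
    refine le_trans ?_ hN.le
    gcongr
    exact hC ζ (by simpa using hζ)

section Shears

variable {E : Type*} [NormedAddCommGroup E] [NormedSpace ℂ E]

/-- The shear `z ↦ z + h (l z) • v` along a vector `v` in the kernel of `l`. -/
def shearEquiv (l : E →L[ℂ] ℂ) (h : ℂ → ℂ) (v : E) (hv : l v = 0) : E ≃ E where
  toFun z := z + h (l z) • v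
  invFun z := z - h (l z) • v
  left_inv z := by simp [hv]
  right_inv z := by simp [hv]

lemma exists_shear (l : E →L[ℂ] ℂ) {p q : E} (hpq : l p = l q) {S : Set E} (hS : S.Finite)
    (hlS : ∀ s ∈ S, l s ≠ l p) {R ε : ℝ} (hR : 0 ≤ R) (hRp : ‖l‖ * R < ‖l p‖) (hε : 0 < ε) :
    ∃ θ : E ≃ E, Differentiable ℂ θ ∧ (∀ s ∈ S, θ s = s) ∧ θ p = q ∧
      ∀ z, ‖z‖ ≤ R → ‖θ z - z‖ ≤ ε := by
  obtain ⟨h, hd, hp, hs, hb⟩ := exists_entire_small_on_disc (hS.image l) (a := l p)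
    (by rintro ⟨s, hs, h⟩; exact hlS s hs h) (by positivity) hRp
    (ε := ε / (‖q - p‖ + 1)) (by positivity)
  refine ⟨shearEquiv l h (q - p) (by simp [hpq]), ?_, fun s hs' => ?_, ?_, fun z hz => ?_⟩
  · exact differentiable_id.add ((hd.comp l.differentiable).smul_const _)
  · simp [shearEquiv, hs (l s) (mem_image_of_mem l hs')]
  · simp [shearEquiv, hp]
  · have h1 := hb (l z) ((l.le_opNorm z).trans (by gcongr))
    simp only [shearEquiv, Equiv.coe_fn_mk, add_sub_cancel_left, norm_smul]
    calc ‖h (l z)‖ * ‖q - p‖ ≤ ε / (‖q - p‖ + 1) * (‖q - p‖ + 1) := by gcongr; linarith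
      _ = ε := by field_simp

/-- A point off a ball can be strictly separated from it by a functional not vanishing on given
nonzero vectors. -/
lemma exists_separating_functional {p : E} {R : ℝ} (hR : 0 ≤ R) (hp : R < ‖p‖)
    [FiniteDimensional ℂ E] {T : Set E} (hT : T.Finite) (hT0 : ∀ u ∈ T, u ≠ 0) :
    ∃ l : E →L[ℂ] ℂ, ‖l‖ * R < ‖l p‖ ∧ ∀ u ∈ T, l u ≠ 0 := by
  obtain ⟨g, hg, hgp⟩ := exists_dual_vector ℂ p (hR.trans_lt hp).ne'
  have := hT.to_subtype
  obtain ⟨m, hm⟩ := Module.exists_dual_forall_apply_ne_zero (K := ℂ) (fun u : T => (u : E))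
    (fun u => hT0 u u.2)
  let m' : E →L[ℂ] ℂ := LinearMap.toContinuousLinearMap m
  have h1 : ∀ᶠ t : ℂ in 𝓝[≠] 0, ‖g + t • m'‖ * R < ‖(g + t • m') p‖ := by
    refine Filter.Eventually.filter_mono nhdsWithin_le_nhds ?_
    have hc1 : Continuous fun t : ℂ => ‖g + t • m'‖ * R := by fun_prop
    have hc2 : Continuous fun t : ℂ => ‖(g + t • m') p‖ := by
      simp only [add_apply, smul_apply]
      fun_prop
    refine hc1.continuousAt.eventually_lt hc2.continuousAt ?_
    have h0 : g + (0 : ℂ) • m' = g := by ext; simp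
    rw [h0, hg, hgp, one_mul]
    simpa using hp
  have h2 : ∀ᶠ t : ℂ in 𝓝[≠] 0, ∀ u ∈ T, (g + t • m') u ≠ 0 := by
    rw [hT.eventually_all]
    intro u hu
    have hmu : m' u ≠ 0 := hm ⟨u, hu⟩
    by_cases hgu : g u = 0
    · filter_upwards [self_mem_nhdsWithin] with t ht
      simpa [hgu] using ⟨ht, hmu⟩
    · refine Filter.Eventually.filter_mono nhdsWithin_le_nhds ?_
      have hc : Continuous fun t : ℂ => (g + t • m') u := by
        simp only [add_apply, smul_apply]
        fun_prop
      exact hc.continuousAt.eventually_ne (by simpa using hgu)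
  obtain ⟨t, ht1, ht2⟩ := (h1.and h2).exists
  exact ⟨_, ht1, ht2⟩

/-- In dimension at least two, an automorphism close to the identity on a ball and fixing finitely
many points can move any other point off the ball to any other such point. -/
lemma exists_automorphism_moving_point [FiniteDimensional ℂ E] (hE : 1 < Module.finrank ℂ E)
    {S : Set E} (hS : S.Finite) {p q : E} (hpS : p ∉ S) (hqS : q ∉ S) {R ε : ℝ} (hR : 0 ≤ R)
    (hp : R < ‖p‖) (hq : R < ‖q‖) (hε : 0 < ε) :
    ∃ θ : E ≃ E, Differentiable ℂ θ ∧ (∀ s ∈ S, θ s = s) ∧ θ p = q ∧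
      ∀ z, ‖z‖ ≤ R → ‖θ z - z‖ ≤ ε := by
  obtain ⟨R', hRR', hR'⟩ := exists_between (lt_min hp hq)
  obtain ⟨hp', hq'⟩ := lt_min_iff.1 hR'
  have hR'0 : 0 ≤ R' := hR.trans hRR'.le
  obtain ⟨l, hl, hlS⟩ := exists_separating_functional hR'0 hp' (T := (fun s => s - p) '' S)
    (hS.image _) (by rintro _ ⟨s, hs, rfl⟩ h; exact hpS (sub_eq_zero.1 h ▸ hs))
  obtain ⟨v, hv, hv0⟩ : ∃ v, l v = 0 ∧ v ≠ 0 := by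
    have hker := LinearMap.ker_ne_bot_of_finrank_lt (f := (l : E →ₗ[ℂ] ℂ)) (by simpa using hE)
    obtain ⟨v, hv, hv0⟩ := Submodule.exists_mem_ne_zero_of_ne_bot hker
    exact ⟨v, hv, hv0⟩
  obtain ⟨m, hm, hmS⟩ := exists_separating_functional hR'0 hq'
    (T := insert v ((fun s => s - q) '' S)) ((hS.image _).insert v) (by
      rintro u (rfl | ⟨s, hs, rfl⟩) h
      · exact hv0 h
      · exact hqS (sub_eq_zero.1 h ▸ hs))
  have hmv : m v ≠ 0 := hmS v (mem_insert _ _)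
  let w : E := p + ((m q - m p) / m v) • v
  have hlw : l p = l w := by simp [w, hv]
  have hmw : m w = m q := by simp [w, hmv]
  obtain ⟨θ₁, hd₁, hs₁, hp₁, hb₁⟩ := exists_shear l hlw hS
    (fun s hs h => hlS (s - p) (mem_image_of_mem _ hs) (by simp [h])) hR'0 hl
    (lt_min (half_pos hε) (sub_pos.2 hRR'))
  obtain ⟨θ₂, hd₂, hs₂, hp₂, hb₂⟩ := exists_shear m hmw hS
    (fun s hs h => hmS (s - q) (mem_insert_of_mem _ (mem_image_of_mem _ hs)) (by simp [h, hmw]))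
    hR'0 (by rw [hmw]; exact hm) (half_pos hε)
  refine ⟨θ₁.trans θ₂, hd₂.comp hd₁, fun s hs => by simp [hs₁ s hs, hs₂ s hs],
    by simp [hp₁, hp₂], fun z hz => ?_⟩
  have h1 := hb₁ z (hz.trans hRR'.le)
  have h2 := hb₂ (θ₁ z) (by
    have h3 := norm_add_le (θ₁ z - z) z
    rw [sub_add_cancel] at h3
    have := h1.trans (min_le_right _ _)
    linarith)
  have h3 := norm_add_le (θ₂ (θ₁ z) - θ₁ z) (θ₁ z - z)
  rw [sub_add_sub_cancel] at h3
  have := h1.trans (min_le_left _ _)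
  simp only [Equiv.trans_apply]
  linarith

end Shears

section OneVariable

/-- An entire function with its only zero at `1`, arbitrarily close to `1` on the disc of
radius `1 / 2`. -/
lemma exists_weierstrass_factor {ε : ℝ} (hε : 0 < ε) :
    ∃ u : ℂ → ℂ, Differentiable ℂ u ∧ (∀ z, u z = 0 ↔ z = 1) ∧
      ∀ z, ‖z‖ ≤ 1 / 2 → ‖u z - 1‖ ≤ ε := by
  obtain ⟨N, hN⟩ := exists_pow_lt_of_lt_one (half_pos hε) (show (1 / 2 : ℝ) < 1 by norm_num)
  have hdiff : Differentiable ℂ (Complex.logTaylor (N + 1)) :=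
    fun z => (Complex.hasDerivAt_logTaylor N z).differentiableAt
  refine ⟨fun z => (1 - z) * Complex.exp (-Complex.logTaylor (N + 1) (-z)),
    by fun_prop, fun z => ?_, fun z hz => ?_⟩
  · rw [mul_eq_zero, or_iff_left (Complex.exp_ne_zero _), sub_eq_zero, eq_comm]
  · have hz1 : ‖-z‖ < 1 := by rw [norm_neg]; linarith
    have hne : 1 + -z ≠ 0 := fun h => by
      rw [← sub_eq_add_neg, sub_eq_zero] at h
      rw [← h] at hz
      norm_num at hz
    have hw := Complex.norm_log_sub_logTaylor_le N hz1
    set w := Complex.log (1 + -z) - Complex.logTaylor (N + 1) (-z) with hwdef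
    have heq : (1 - z) * Complex.exp (-Complex.logTaylor (N + 1) (-z)) = Complex.exp w := by
      rw [hwdef, sub_eq_add_neg (Complex.log _), Complex.exp_add, Complex.exp_log hne,
        sub_eq_add_neg]
    have hw' : ‖w‖ ≤ (1 / 2) ^ N := by
      refine hw.trans ?_
      rw [norm_neg]
      have h1 : (1 - ‖z‖)⁻¹ ≤ 2 := by
        rw [inv_le_comm₀ (by linarith) (by norm_num)]; linarith
      calc ‖z‖ ^ (N + 1) * (1 - ‖z‖)⁻¹ / (N + 1) ≤ ‖z‖ ^ (N + 1) * (1 - ‖z‖)⁻¹ :=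
            div_le_self (mul_nonneg (by positivity) (inv_nonneg.2 (by linarith)))
              (by linarith [(Nat.cast_nonneg N : (0 : ℝ) ≤ N)])
        _ ≤ (1 / 2) ^ (N + 1) * 2 :=
            mul_le_mul (by gcongr) h1 (inv_nonneg.2 (by linarith)) (by positivity)
        _ = (1 / 2) ^ N := by rw [pow_succ]; ring
    have h1 : ((1 : ℝ) / 2) ^ N ≤ 1 := pow_le_one₀ (by norm_num) (by norm_num)
    simp only [heq]
    have := Complex.norm_exp_sub_one_le (hw'.trans h1)
    linarith

lemma exists_add_zero_of_fin_one {F : (Fin 1 → ℂ) → (Fin 1 → ℂ)} (hF : Differentiable ℂ F)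
    {p : Fin 1 → ℂ} (hp : p ≠ 0) {ε : ℝ} (hε : 0 < ε) :
    ∃ F' : (Fin 1 → ℂ) → (Fin 1 → ℂ), Differentiable ℂ F' ∧
      (∀ z, F' z = 0 ↔ z = p ∨ F z = 0) ∧ ∀ z, ‖z‖ ≤ ‖p‖ / 2 → ‖F' z - F z‖ ≤ ε := by
  have hnorm : ∀ z : Fin 1 → ℂ, ‖z‖ = ‖z 0‖ := fun z => by
    simp [Pi.norm_def]
  have hp0 : p 0 ≠ 0 := by rwa [← norm_ne_zero_iff, ← hnorm, norm_ne_zero_iff]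
  obtain ⟨C, hC⟩ := (isCompact_closedBall (0 : Fin 1 → ℂ) (‖p‖ / 2)).exists_bound_of_continuousOn
    hF.continuous.continuousOn
  have hC0 : 0 ≤ C := (norm_nonneg _).trans (hC 0 (by simp; positivity))
  obtain ⟨u, hu, hu0, hu1⟩ := exists_weierstrass_factor (ε := ε / (C + 1)) (by positivity)
  refine ⟨fun z => u (z 0 / p 0) • F z, ?_, fun z => ?_, fun z hz => ?_⟩
  · exact (hu.comp (by fun_prop : Differentiable ℂ fun z : Fin 1 → ℂ => z 0 / p 0)).smul hF
  · rw [smul_eq_zero, hu0, div_eq_one_iff_eq hp0]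
    refine or_congr_left ⟨fun h => ?_, fun h => by rw [h]⟩
    ext i
    rw [Subsingleton.elim i 0, h]
  · have h1 := hu1 (z 0 / p 0) (by
      rw [norm_div, ← hnorm, ← hnorm, div_le_iff₀ (norm_pos_iff.2 hp)]
      linarith)
    have h2 := hC z (by simpa using hz)
    have h3 : u (z 0 / p 0) • F z - F z = (u (z 0 / p 0) - 1) • F z := by
      rw [sub_smul, one_smul]
    rw [h3, norm_smul]
    calc ‖u (z 0 / p 0) - 1‖ * ‖F z‖ ≤ ε / (C + 1) * (C + 1) := by gcongr; linarith
      _ = ε := by field_simp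

end OneVariable

section SeveralVariables

variable {n : ℕ}

/-- Maps obtained by composing `w ↦ (w₁, …, g (wᵢ), …, wₙ)` with a bijective entire map. -/
def IsModelMap (i : Fin n) (F : (Fin n → ℂ) → (Fin n → ℂ)) : Prop :=
  ∃ Φ : (Fin n → ℂ) ≃ (Fin n → ℂ), Differentiable ℂ Φ ∧ ∃ g : ℂ → ℂ, Differentiable ℂ g ∧
    ∀ z, F z = Function.update (Φ z) i (g (Φ z i))

lemma update_eq_zero_iff (i : Fin n) (w : Fin n → ℂ) (c : ℂ) :
    Function.update w i c = 0 ↔ c = 0 ∧ ∀ j, j ≠ i → w j = 0 := by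
  rw [Function.update_eq_iff]
  simp

lemma differentiable_update_comp (i : Fin n) {Φ : (Fin n → ℂ) → (Fin n → ℂ)}
    (hΦ : Differentiable ℂ Φ) {g : ℂ → ℂ} (hg : Differentiable ℂ g) :
    Differentiable ℂ fun z => Function.update (Φ z) i (g (Φ z i)) := by
  rw [differentiable_pi] at hΦ ⊢
  intro j
  rcases eq_or_ne j i with rfl | hj
  · simpa [Function.comp_def] using hg.comp (hΦ j)
  · simpa [hj] using hΦ j

lemma IsModelMap.differentiable {i : Fin n} {F : (Fin n → ℂ) → (Fin n → ℂ)}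
    (hF : IsModelMap i F) : Differentiable ℂ F := by
  obtain ⟨Φ, hΦ, g, hg, h⟩ := hF
  rw [funext h]
  exact differentiable_update_comp i hΦ hg

lemma IsModelMap.exists_add_zero (hn : 1 < n) {i : Fin n} {F : (Fin n → ℂ) → (Fin n → ℂ)}
    (hF : IsModelMap i F) {S : Set (Fin n → ℂ)} (hS : S.Finite) (hFS : ∀ z, F z = 0 ↔ z ∈ S)
    {p : Fin n → ℂ} (hpS : p ∉ S) (hp : p ≠ 0) {ε : ℝ} (hε : 0 < ε) :
    ∃ F', IsModelMap i F' ∧ (∀ z, F' z = 0 ↔ z = p ∨ z ∈ S) ∧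
      ∀ z, ‖z‖ ≤ ‖p‖ / 2 → ‖F' z - F z‖ ≤ ε := by
  obtain ⟨Φ, hΦ, g, hg, hFΦ⟩ := hF
  have hp' : 0 < ‖p‖ := norm_pos_iff.2 hp
  have hB : IsCompact (Metric.closedBall (0 : Fin n → ℂ) (‖p‖ / 2)) := isCompact_closedBall _ _
  obtain ⟨C, hC⟩ := hB.exists_bound_of_continuousOn (f := fun z => g (Φ z i) * Φ z i)
    (by
      have h1 : Continuous fun z => Φ z i := (continuous_apply i).comp hΦ.continuous
      exact ((hg.continuous.comp h1).mul h1).continuousOn)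
  obtain ⟨D, hD⟩ := (hB.union hS.isCompact).exists_bound_of_continuousOn (f := Φ)
    hΦ.continuous.continuousOn
  obtain ⟨b, hbD, hbC, hb0⟩ : ∃ b : ℝ, D < b ∧ C ≤ ε / 2 * b ∧ 0 < b := by
    refine ⟨max (D + 1) (max (C / (ε / 2)) 1), ?_, ?_, ?_⟩
    · exact (lt_add_one D).trans_le (le_max_left _ _)
    · rw [mul_comm, ← div_le_iff₀ (by positivity)]
      exact (le_max_left _ _).trans (le_max_right _ _)
    · exact zero_lt_one.trans_le ((le_max_right _ _).trans (le_max_right _ _))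
  have hbne : (b : ℂ) ≠ 0 := by exact_mod_cast hb0.ne'
  let q : Fin n → ℂ := Φ.symm (Pi.single i (b : ℂ))
  have hΦq : Φ q = Pi.single i (b : ℂ) := Φ.apply_symm_apply _
  have hqD : ∀ z, ‖Φ z‖ ≤ D → z ≠ q := by
    rintro z hz rfl
    rw [hΦq, Pi.norm_single, Complex.norm_real, Real.norm_of_nonneg hb0.le] at hz
    linarith
  have hqS : q ∉ S := fun h => hqD q (hD q (Or.inr h)) rfl
  have hqB : ‖p‖ / 2 < ‖q‖ := by
    by_contra! h
    exact hqD q (hD q (Or.inl (by simpa using h))) rfl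
  let g' : ℂ → ℂ := fun t => g t * (1 - t / b)
  have hg' : Differentiable ℂ g' := by fun_prop
  let H : (Fin n → ℂ) → (Fin n → ℂ) := fun z => Function.update (Φ z) i (g' (Φ z i))
  have hH : Differentiable ℂ H := differentiable_update_comp i hΦ hg'
  have hH0 : ∀ y, H y = 0 ↔ y = q ∨ y ∈ S := by
    intro y
    rw [← hFS, hFΦ, update_eq_zero_iff, update_eq_zero_iff, mul_eq_zero, sub_eq_zero,
      eq_comm (a := (1 : ℂ)), div_eq_one_iff_eq hbne]
    have hy : y = q ↔ Φ y i = b ∧ ∀ j, j ≠ i → Φ y j = 0 := by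
      rw [← Φ.injective.eq_iff, hΦq]
      constructor
      · intro h
        rw [h]
        exact ⟨by simp, fun j hj => by simp [hj]⟩
      · rintro ⟨h1, h2⟩
        ext j
        rcases eq_or_ne j i with rfl | hj
        · simp [h1]
        · simp [h2 j hj, hj]
    rw [hy]
    tauto
  have hHF : ∀ z, ‖z‖ ≤ ‖p‖ / 2 → ‖H z - F z‖ ≤ ε / 2 := by
    intro z hz
    refine (pi_norm_le_iff_of_nonneg (by positivity)).2 fun j => ?_
    rw [hFΦ]
    rcases eq_or_ne j i with rfl | hj
    · have h1 : H z j - Function.update (Φ z) j (g (Φ z j)) j = -(g (Φ z j) * Φ z j / b) := by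
        simp only [H, g', Function.update_self]; ring
      rw [Pi.sub_apply, h1, norm_neg, norm_div, Complex.norm_real, Real.norm_of_nonneg hb0.le,
        div_le_iff₀ hb0]
      exact (hC z (by simpa using hz)).trans hbC
    · simp [H, hj, (half_pos hε).le]
  obtain ⟨δ, hδ, hHδ⟩ := Metric.uniformContinuousOn_iff.1
    ((isCompact_closedBall (0 : Fin n → ℂ) (‖p‖ / 2 + 1)).uniformContinuousOn_of_continuous
      hH.continuous.continuousOn) (ε / 2) (half_pos hε)
  obtain ⟨θ, hθ, hθS, hθp, hθb⟩ := exists_automorphism_moving_point (by simpa using hn) hS hpS hqS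
    (R := ‖p‖ / 2) (ε := min (δ / 2) 1) (by positivity) (by linarith) hqB (by positivity)
  refine ⟨fun z => H (θ z), ⟨θ.trans Φ, hΦ.comp hθ, g', hg', fun z => rfl⟩, fun z => ?_,
    fun z hz => ?_⟩
  · rw [hH0, ← hθp, θ.injective.eq_iff]
    refine or_congr_right ⟨fun h => ?_, fun h => by rwa [hθS z h]⟩
    rwa [← θ.injective (hθS _ h)]
  · have h1 := hθb z hz
    have h2 := norm_add_le (θ z - z) z
    rw [sub_add_cancel] at h2
    have h3 := hHδ (θ z) (by
      have := h1.trans (min_le_right _ _)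
      simp only [Metric.mem_closedBall, dist_zero_right]; linarith) z
      (by simp only [Metric.mem_closedBall, dist_zero_right]; linarith) (by
        have := h1.trans (min_le_left _ _)
        rw [dist_eq_norm]; linarith)
    rw [dist_eq_norm] at h3
    have h4 := norm_add_le (H (θ z) - H z) (H z - F z)
    rw [sub_add_sub_cancel] at h4
    linarith [hHF z hz]

end SeveralVariables

lemma tendsto_norm_atTop_of_not_accPt {E : Type*} [NormedAddCommGroup E] [ProperSpace E]
    {x : ℕ → E} (hinj : Function.Injective x) (hdisc : ∀ z, ¬ AccPt z (𝓟 (range x))) :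
    Tendsto (fun k => ‖x k‖) atTop atTop := by
  refine tendsto_atTop.2 fun R => ?_
  have hfin : (range x ∩ Metric.closedBall 0 R).Finite := by
    by_contra h
    obtain ⟨z, -, hz⟩ := Set.Infinite.exists_accPt_of_subset_isCompact h
      (isCompact_closedBall (0 : E) R) inter_subset_right
    exact hdisc z (hz.mono (principal_mono.2 inter_subset_left))
  have h2 := (hfin.preimage hinj.injOn)
  rw [← Nat.cofinite_eq_atTop]
  filter_upwards [h2.compl_mem_cofinite] with k hk
  by_contra! h
  exact hk ⟨mem_range_self k, by simpa using h.le⟩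

/-- A sequence of nonzero vectors tending to infinity in `ℂⁿ` is the zero set of an entire map
to `ℂⁿ`. -/
lemma exists_entire_map_zeroSet_eq_range {n : ℕ} (hn : 0 < n) (x : ℕ → (Fin n → ℂ))
    (hinj : Function.Injective x) (h0 : ∀ k, x k ≠ 0)
    (hx : Tendsto (fun k => ‖x k‖) atTop atTop) :
    ∃ f : (Fin n → ℂ) → (Fin n → ℂ), Differentiable ℂ f ∧ {z | f z = 0} = range x := by
  rcases (Nat.succ_le_of_lt hn).eq_or_lt with rfl | hn1
  · refine exists_entire_zeroSet_eq_range (fun F => Differentiable ℂ F) (fun F hF => hF)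
      ⟨fun _ => 1, differentiable_const _, fun _ => one_ne_zero⟩
      (fun F hF S _ hFS p _ hp ε hε => ?_) x hinj h0 hx
    obtain ⟨F', hF', hz, hd⟩ := exists_add_zero_of_fin_one hF hp hε
    exact ⟨F', hF', fun z => by rw [hz, hFS], hd⟩
  · refine exists_entire_zeroSet_eq_range (IsModelMap ⟨0, hn⟩) (fun F hF => hF.differentiable)
      ⟨fun z => Function.update z ⟨0, hn⟩ 1,
        ⟨Equiv.refl _, differentiable_id, fun _ => 1, differentiable_const _, fun z => rfl⟩,
        fun z h => one_ne_zero ((update_eq_zero_iff _ _ _).1 h).1⟩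
      (fun F hF S hS hFS p hpS hp ε hε => hF.exists_add_zero hn1 hS hFS hpS hp hε) x hinj h0 hx

/-- a closed discrete sequence is the common zero set of `n` entire functions. -/
theorem discrete_sequence_is_common_zero_set {n : ℕ} (x : ℕ → (Fin n → ℂ))
    (hinj : Function.Injective x)
    (hclosed : IsClosed (Set.range x))
    (hdisc : ∀ z : Fin n → ℂ, ¬ AccPt z (Filter.principal (Set.range x))) :
    ∃ f : Fin n → (Fin n → ℂ) → ℂ, (∀ i, Differentiable ℂ (f i)) ∧
      {z : Fin n → ℂ | ∀ i, f i z = 0} = Set.range x := by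
  have hn : 0 < n := by
    rcases Nat.eq_zero_or_pos n with rfl | hn
    · exact absurd (hinj (Subsingleton.elim (x 0) (x 1))) zero_ne_one
    · exact hn
  have : Nonempty (Fin n) := ⟨⟨0, hn⟩⟩
  obtain ⟨a, ha⟩ : ∃ a, a ∉ range x :=
    ((countable_range x).dense_compl ℝ).nonempty
  have hnorm : Tendsto (fun k => ‖x k - a‖) atTop atTop :=
    tendsto_atTop_mono (fun k => norm_sub_norm_le (x k) a)
      (tendsto_atTop_add_const_right _ (-‖a‖) (tendsto_norm_atTop_of_not_accPt hinj hdisc))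
  obtain ⟨f, hf, hfx⟩ := exists_entire_map_zeroSet_eq_range hn (fun k => x k - a)
    (fun j k h => hinj (sub_left_injective h))
    (fun k h => ha ⟨k, sub_eq_zero.1 h⟩) hnorm
  refine ⟨fun i z => f (z - a) i, fun i => ?_, ?_⟩
  · exact (differentiable_pi.1 hf i).comp (differentiable_id.sub_const a)
  · ext z
    have h := Set.ext_iff.1 hfx (z - a)
    simp only [mem_ofPred_eq, mem_range, sub_left_inj] at h
    simpa [funext_iff] using h
end
end

section
/- Let M ⊆ ℂⁿ be a closed set which is a Carleman continuum, and let E ⊆ ℂⁿ \ M be a closed discrete subset of ℂⁿ (every point of E is isolated in E and E has no accumulation point in ℂⁿ), disjoint from M. Then M ∪ E is a Carleman continuum with interpolation on E: for every continuous q : M ∪ E → ℂ and every continuous ε : M ∪ E → (0,∞) there exists an entire function g on ℂⁿ such that |g(x) − q(x)| < ε(x) for all x ∈ M ∪ E and g(z) = q(z) for all z ∈ E. -/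
open Set

noncomputable section

open Filter Topology

/-- A series of entire functions whose `m`-th term is at most `2⁻ᵐ` on the ball of radius `m`
has an entire sum. -/
theorem differentiable_tsum_of_norm_le_on_closedBall {V : Type*} [NormedAddCommGroup V]
    [NormedSpace ℂ V] {f : ℕ → V → ℂ} (hf : ∀ m, Differentiable ℂ (f m))
    (hb : ∀ m : ℕ, ∀ z ∈ Metric.closedBall (0 : V) m, ‖f m z‖ ≤ (1 / 2) ^ m) :
    Differentiable ℂ fun z => ∑' m, f m z := by
  have hsum : ∀ z, Summable fun m => f m z := by
    intro z
    obtain ⟨N, hN⟩ := exists_nat_ge ‖z‖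
    rw [← summable_nat_add_iff N]
    refine Summable.of_norm_bounded ((summable_nat_add_iff N).2 summable_geometric_two) ?_
    intro m
    refine hb (m + N) z ?_
    rw [mem_closedBall_zero_iff]
    push_cast
    linarith [(Nat.cast_nonneg m : (0 : ℝ) ≤ m)]
  intro x
  obtain ⟨N, hN⟩ := exists_nat_gt (‖x‖ + 1)
  have hx : x ∈ Metric.ball (0 : V) (N - 1) := by
    rw [mem_ball_zero_iff]; linarith
  have hsplit : (fun z => ∑' m, f m z) =
      fun z => ∑ i ∈ Finset.range N, f i z + ∑' m, f (m + N) z := by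
    funext z
    exact ((hsum z).sum_add_tsum_nat_add N).symm
  rw [hsplit]
  refine DifferentiableAt.add (DifferentiableAt.fun_sum fun i _ => hf i x) ?_
  refine (hasFDerivAt_tsum_of_isPreconnected (u := fun m => 2 * (1 / 2 : ℝ) ^ (m + N))
    (((summable_nat_add_iff N).2 summable_geometric_two).mul_left 2) Metric.isOpen_ball
    (convex_ball (0 : V) (N - 1 : ℝ)).isPreconnected
    (fun m z _ => (hf (m + N) z).hasFDerivAt) ?_ hx
    ((summable_nat_add_iff N).2 (hsum x)) hx).differentiableAt
  intro m z hz
  have hle : ∀ w ∈ Metric.ball z 1, ‖f (m + N) w‖ ≤ (1 / 2) ^ (m + N) := by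
    intro w hw
    refine hb (m + N) w ?_
    rw [mem_ball_zero_iff] at hz
    rw [mem_ball_iff_norm] at hw
    rw [mem_closedBall_zero_iff]
    push_cast
    have := norm_le_norm_add_norm_sub' w z
    linarith [(Nat.cast_nonneg m : (0 : ℝ) ≤ m)]
  have hmaps : MapsTo (f (m + N)) (Metric.ball z 1)
      (Metric.closedBall (f (m + N) z) (2 * (1 / 2) ^ (m + N))) := by
    intro w hw
    rw [mem_closedBall_iff_norm]
    have := norm_sub_le (f (m + N) w) (f (m + N) z)
    linarith [hle w hw, hle z (Metric.mem_ball_self one_pos)]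
  simpa using Complex.norm_fderiv_le_div_of_mapsTo_ball (hf (m + N)).differentiableOn hmaps one_pos

/-- A finite set of points admits entire functions separating one point from the others. -/
theorem exists_differentiable_separating {n : ℕ} (S : Finset (Fin n → ℂ)) (e : Fin n → ℂ) :
    ∃ p : (Fin n → ℂ) → ℂ, Differentiable ℂ p ∧ p e = 1 ∧ ∀ s ∈ S, s ≠ e → p s = 0 := by
  have hcoord : ∀ s : Fin n → ℂ, ∃ l : (Fin n → ℂ) → ℂ,
      Differentiable ℂ l ∧ l e = 1 ∧ (s ≠ e → l s = 0) := by
    intro s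
    by_cases hs : s = e
    · exact ⟨fun _ => 1, by fun_prop, rfl, fun h => absurd hs h⟩
    · obtain ⟨i, hi⟩ := Function.ne_iff.1 hs
      refine ⟨fun z => (z i - s i) * (e i - s i)⁻¹, by fun_prop, ?_, by simp⟩
      exact mul_inv_cancel₀ (sub_ne_zero.2 hi.symm)
  choose l hl hle hls using hcoord
  refine ⟨fun z => ∏ s ∈ S, l s z, ?_, ?_, ?_⟩
  · classical
    exact fun z =>
      (HasFDerivAt.finsetProd fun s _ => (hl s z).hasFDerivAt).differentiableAt
  · exact Finset.prod_eq_one fun s _ => hle s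
  · intro s hs hse
    exact Finset.prod_eq_zero hs (hls s hse)

theorem exists_differentiable_separating_small {n : ℕ} (S : Finset (Fin n → ℂ))
    (e : Fin n → ℂ) {r δ : ℝ} (hr : 0 ≤ r) (hre : r < ‖e‖) (hδ : 0 < δ) :
    ∃ h : (Fin n → ℂ) → ℂ, Differentiable ℂ h ∧ h e = 1 ∧ (∀ s ∈ S, s ≠ e → h s = 0) ∧
      ∀ z ∈ Metric.closedBall (0 : Fin n → ℂ) r, ‖h z‖ ≤ δ := by
  obtain ⟨p, hp, hpe, hps⟩ := exists_differentiable_separating S e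
  obtain ⟨i, hi⟩ : ∃ i, r < ‖e i‖ := by
    by_contra! hcon
    exact absurd ((pi_norm_le_iff_of_nonneg hr).2 hcon) (not_le.2 hre)
  have hpos : 0 < ‖e i‖ := hr.trans_lt hi
  obtain ⟨C, hC⟩ := (isCompact_closedBall (0 : Fin n → ℂ) r).exists_bound_of_continuousOn
    hp.continuous.continuousOn
  have hC0 : 0 ≤ C := (norm_nonneg _).trans (hC 0 (Metric.mem_closedBall_self hr))
  have hlim : Tendsto (fun N : ℕ => (r / ‖e i‖) ^ N * C) atTop (𝓝 0) := by
    simpa using (tendsto_pow_atTop_nhds_zero_of_lt_one (by positivity)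
      ((div_lt_one hpos).2 hi)).mul_const C
  obtain ⟨N, hN⟩ := (hlim.eventually (gt_mem_nhds hδ)).exists
  refine ⟨fun z => (z i * (e i)⁻¹) ^ N * p z, by fun_prop, ?_, ?_, ?_⟩
  · simp [hpe, mul_inv_cancel₀ (norm_pos_iff.1 hpos)]
  · intro s hs hse
    simp [hps s hs hse]
  · intro z hz
    refine le_trans ?_ hN.le
    have hzi : ‖z i‖ ≤ r := (norm_le_pi_norm z i).trans (mem_closedBall_zero_iff.1 hz)
    rw [norm_mul, norm_pow, norm_mul, norm_inv, ← div_eq_mul_inv]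
    have := hC z hz
    gcongr

/-- Finite interpolation by entire functions that are small on a ball where the data vanish. -/
theorem exists_differentiable_interpolating_finset {n : ℕ} (S : Finset (Fin n → ℂ))
    (w : (Fin n → ℂ) → ℂ) {r δ : ℝ} (hr : 0 ≤ r) (hδ : 0 < δ)
    (hw : ∀ s ∈ S, ‖s‖ ≤ r → w s = 0) :
    ∃ h : (Fin n → ℂ) → ℂ, Differentiable ℂ h ∧ (∀ s ∈ S, h s = w s) ∧
      ∀ z ∈ Metric.closedBall (0 : Fin n → ℂ) r, ‖h z‖ ≤ δ := by
  have hterm : ∀ e ∈ S, ∃ h : (Fin n → ℂ) → ℂ, Differentiable ℂ h ∧ h e = w e ∧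
      (∀ s ∈ S, s ≠ e → h s = 0) ∧
      ∀ z ∈ Metric.closedBall (0 : Fin n → ℂ) r, ‖h z‖ ≤ δ / (S.card + 1) := by
    intro e he
    by_cases hwe : w e = 0
    · exact ⟨fun _ => 0, by fun_prop, hwe.symm, fun _ _ _ => rfl, fun z _ => by
        simp only [norm_zero]; positivity⟩
    · have hre : r < ‖e‖ := not_le.1 fun h => hwe (hw e he h)
      have hwpos : 0 < ‖w e‖ := norm_pos_iff.2 hwe
      obtain ⟨h, hh, hhe, hhs, hhz⟩ := exists_differentiable_separating_small S e hr hre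
        (δ := δ / (S.card + 1) / ‖w e‖) (by positivity)
      refine ⟨fun z => w e * h z, by fun_prop, by simp [hhe], fun s hs hse => by
        simp [hhs s hs hse], fun z hz => ?_⟩
      rw [norm_mul, mul_comm, ← le_div_iff₀ hwpos]
      exact hhz z hz
  choose! h hh hhe hhs hhz using hterm
  refine ⟨fun z => ∑ e ∈ S, h e z, Differentiable.fun_sum fun e he => hh e he, ?_, ?_⟩
  · intro s hs
    rw [← hhe s hs]
    exact Finset.sum_eq_single_of_mem s hs fun e he hes => hhs e he s hs hes.symm
  · intro z hz
    refine (norm_sum_le_of_le S fun e he => hhz e he z hz).trans ?_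
    rw [Finset.sum_const, nsmul_eq_mul, mul_div_assoc', div_le_iff₀ (by positivity)]
    nlinarith

/-- Arbitrary values on a locally finite set are interpolated by an entire function. -/
theorem exists_differentiable_interpolating {n : ℕ} (E : Set (Fin n → ℂ))
    (hE : ∀ r : ℝ, (E ∩ Metric.closedBall 0 r).Finite) (v : (Fin n → ℂ) → ℂ) :
    ∃ F : (Fin n → ℂ) → ℂ, Differentiable ℂ F ∧ ∀ z ∈ E, F z = v z := by
  have hstep : ∀ (m : ℕ) (g : (Fin n → ℂ) → ℂ), ∃ h : (Fin n → ℂ) → ℂ, Differentiable ℂ h ∧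
      ((∀ z ∈ E, ‖z‖ ≤ m → g z = v z) →
        (∀ z ∈ E, ‖z‖ ≤ (m + 1 : ℕ) → h z = v z - g z) ∧
        ∀ z ∈ Metric.closedBall (0 : Fin n → ℂ) m, ‖h z‖ ≤ (1 / 2) ^ m) := by
    intro m g
    by_cases hg : ∀ z ∈ E, ‖z‖ ≤ m → g z = v z
    · obtain ⟨h, hh, hs, hb⟩ := exists_differentiable_interpolating_finset
        (hE (m + 1 : ℕ)).toFinset (fun z => v z - g z) (r := m) (δ := (1 / 2) ^ m)
        (by positivity) (by positivity) (fun s hs hsm => by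
          rw [hg s (by simpa using ((hE (m + 1 : ℕ)).mem_toFinset.1 hs).1) hsm, sub_self])
      refine ⟨h, hh, fun _ => ⟨fun z hz hzm => hs z ?_, hb⟩⟩
      rw [Set.Finite.mem_toFinset]
      exact ⟨hz, mem_closedBall_zero_iff.2 hzm⟩
    · exact ⟨fun _ => 0, by fun_prop, fun h => absurd h hg⟩
  choose h hh hspec using hstep
  let G : ℕ → (Fin n → ℂ) → ℂ :=
    fun m => Nat.rec (fun _ => v 0) (fun m g z => g z + h m g z) m
  have hG : ∀ m : ℕ, ∀ z ∈ E, ‖z‖ ≤ m → G m z = v z := by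
    intro m
    induction m with
    | zero =>
      intro z _ hz
      have : z = 0 := norm_le_zero_iff.1 (by simpa using hz)
      rw [this]
      rfl
    | succ m ih =>
      intro z hz hzm
      change G m z + h m (G m) z = v z
      rw [(hspec m (G m) ih).1 z hz hzm]
      ring
  refine ⟨fun z => v 0 + ∑' m, h m (G m) z, ?_, ?_⟩
  · exact (differentiable_const _).add (differentiable_tsum_of_norm_le_on_closedBall
      (fun m => hh m (G m)) fun m => (hspec m (G m) (hG m)).2)
  · intro z hz
    obtain ⟨N, hN⟩ := exists_nat_ge ‖z‖
    have hsub : ∀ m, h m (G m) z = G (m + 1) z - G m z := fun m => by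
      change _ = G m z + h m (G m) z - G m z
      ring
    have htail : ∀ m ∉ Finset.range N, h m (G m) z = 0 := by
      intro m hm
      have hNm : (N : ℝ) ≤ m := by exact_mod_cast not_lt.1 (Finset.mem_range.not.1 hm)
      rw [hsub, hG m z hz (hN.trans hNm), hG (m + 1) z hz (by push_cast; linarith), sub_self]
    change v 0 + ∑' m, h m (G m) z = v z
    rw [tsum_eq_sum htail, Finset.sum_congr rfl fun m _ => hsub m,
      Finset.sum_range_sub (fun m => G m z), hG N z hz hN]
    change v 0 + (v z - v 0) = v z
    ring

theorem exists_differentiable_interpolating_int (c : ℤ → ℂ) :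
    ∃ F : ℂ → ℂ, Differentiable ℂ F ∧ ∀ m : ℤ, F m = c m := by
  let ι : ℤ → Fin 1 → ℂ := fun m _ => m
  have hnorm : ∀ m, ‖ι m‖ = ‖m‖ := fun m => by
    simp [ι, pi_norm_const, Int.norm_eq_abs]
  have hinj : Function.Injective ι := fun a b hab => by
    simpa [ι] using congrFun hab 0
  obtain ⟨F, hF, hFv⟩ := exists_differentiable_interpolating (range ι) (fun r => by
      refine ((isCompact_closedBall (0 : ℤ) r).finite_of_discrete.image ι).subset ?_
      rintro _ ⟨⟨m, rfl⟩, hm⟩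
      refine mem_image_of_mem ι ?_
      rw [mem_closedBall_zero_iff] at hm ⊢
      rwa [← hnorm m]) (Function.extend ι c 0)
  refine ⟨fun z => F fun _ => z, by fun_prop, fun m => ?_⟩
  exact (hFv (ι m) (mem_range_self m)).trans (hinj.extend_apply c 0 m)

/-- A nonempty countable locally finite subset of `ℂⁿ` is the common zero set of finitely many
entire functions. -/
theorem exists_differentiable_common_zeros {n : ℕ} (E : Set (Fin n → ℂ))
    (hE : ∀ r : ℝ, (E ∩ Metric.closedBall 0 r).Finite) (hne : E.Nonempty)
    (hcount : E.Countable) :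
    ∃ P : Option (Fin n) → (Fin n → ℂ) → ℂ, (∀ i, Differentiable ℂ (P i)) ∧
      ∀ z, z ∈ E ↔ ∀ i, P i z = 0 := by
  obtain ⟨f, rfl⟩ := hcount.exists_eq_range hne
  obtain ⟨φ, hφ, hφv⟩ := exists_differentiable_interpolating (range f) hE
    fun z => ((Function.invFun f z : ℕ) : ℂ)
  have hint : ∀ i : Fin n, ∃ F : ℂ → ℂ, Differentiable ℂ F ∧ ∀ m : ℤ, F m = f m.toNat i :=
    fun i => exists_differentiable_interpolating_int fun m => f m.toNat i
  choose F hF hFv using hint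
  have hFnat : ∀ i (k : ℕ), F i k = f k i := fun i k => by simpa using hFv i k
  refine ⟨fun o => o.elim (fun z => Complex.sin (Real.pi * φ z)) fun i z => z i - F i (φ z),
    ?_, ?_⟩
  · rintro (_ | i)
    · exact Complex.differentiable_sin.comp (hφ.const_mul _)
    · exact (differentiable_apply i).sub ((hF i).comp hφ)
  · intro z
    constructor
    · intro hz
      have hfz : f (Function.invFun f z) = z := Function.invFun_eq hz
      rintro (_ | i)
      · change Complex.sin (Real.pi * φ z) = 0
        rw [hφv z hz, mul_comm]
        exact Complex.sin_nat_mul_pi _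
      · change z i - F i (φ z) = 0
        rw [hφv z hz, hFnat, hfz, sub_self]
    · intro hz
      have hsin : Complex.sin (Real.pi * φ z) = 0 := hz none
      obtain ⟨k, hk⟩ := Complex.sin_eq_zero_iff.1 hsin
      have hφz : φ z = k := by
        have hpi : (Real.pi : ℂ) ≠ 0 := by exact_mod_cast Real.pi_ne_zero
        exact mul_left_cancel₀ hpi (hk.trans (mul_comm _ _))
      refine ⟨k.toNat, funext fun i => ?_⟩
      have hi : z i - F i (φ z) = 0 := hz (some i)
      rw [hφz, hFv] at hi
      exact (sub_eq_zero.1 hi).symm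

/-- On a Carleman continuum that misses the common zeros of finitely many entire functions there
are arbitrarily small entire functions equal to `1` on those common zeros. -/
theorem IsCarleman.exists_small_eq_one {n : ℕ} {M : Set (Fin n → ℂ)} (hM : IsCarleman M)
    {ι : Type*} [Fintype ι] {P : ι → (Fin n → ℂ) → ℂ} (hP : ∀ i, Differentiable ℂ (P i))
    (hPM : ∀ x ∈ M, ∃ i, P i x ≠ 0) {ε : (Fin n → ℂ) → ℝ} (hε : ContinuousOn ε M)
    (hεpos : ∀ x ∈ M, 0 < ε x) :
    ∃ G : (Fin n → ℂ) → ℂ, Differentiable ℂ G ∧ (∀ z, (∀ i, P i z = 0) → G z = 1) ∧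
      ∀ x ∈ M, ‖G x‖ < ε x := by
  let D : (Fin n → ℂ) → ℂ := fun x => ∑ j, P j x * star (P j x)
  have hD : ∀ x, D x = ((∑ j, ‖P j x‖ ^ 2 : ℝ) : ℂ) := fun x => by
    simp only [D, RCLike.star_def, Complex.mul_conj, Complex.normSq_eq_norm_sq]
    push_cast
    rfl
  have hDne : ∀ x ∈ M, D x ≠ 0 := by
    intro x hx
    obtain ⟨i, hi⟩ := hPM x hx
    rw [hD]
    refine Complex.ofReal_ne_zero.2 (ne_of_gt ?_)
    exact Finset.sum_pos' (fun j _ => by positivity)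
      ⟨i, Finset.mem_univ i, by have := norm_pos_iff.2 hi; positivity⟩
  have hPc : ∀ i, Continuous (P i) := fun i => (hP i).continuous
  have hpos : ∀ x, 0 < 1 + ∑ j, ‖P j x‖ := fun x => by positivity
  have happrox : ∀ i, ∃ g : (Fin n → ℂ) → ℂ, Differentiable ℂ g ∧ ∀ x ∈ M,
      ‖g x - star (P i x) / D x‖ < ε x / (1 + ∑ j, ‖P j x‖) := by
    intro i
    refine hM _ ?_ _ ?_ fun x hx => div_pos (hεpos x hx) (hpos x)
    · exact ContinuousOn.div (by fun_prop) (by fun_prop) hDne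
    · exact hε.div (by fun_prop) fun x _ => (hpos x).ne'
  choose g hg hgM using happrox
  refine ⟨fun z => 1 - ∑ i, P i z * g i z, ?_, ?_, ?_⟩
  · exact (differentiable_const _).sub (Differentiable.fun_sum fun i _ => (hP i).mul (hg i))
  · intro z hz
    simp [hz]
  · intro x hx
    have hone : (1 : ℂ) = ∑ i, P i x * (star (P i x) / D x) := by
      simp_rw [← mul_div_assoc, ← Finset.sum_div]
      exact (div_self (hDne x hx)).symm
    have heq : 1 - ∑ i, P i x * g i x = -∑ i, P i x * (g i x - star (P i x) / D x) := by
      simp_rw [mul_sub, Finset.sum_sub_distrib]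
      rw [← hone]
      ring
    have hbound : ‖1 - ∑ i, P i x * g i x‖ ≤
        ∑ i, ‖P i x‖ * (ε x / (1 + ∑ j, ‖P j x‖)) := by
      rw [heq, norm_neg]
      refine norm_sum_le_of_le _ fun i _ => ?_
      rw [norm_mul]
      exact mul_le_mul_of_nonneg_left (hgM i x hx).le (norm_nonneg _)
    refine hbound.trans_lt ?_
    rw [← Finset.sum_mul, mul_div_assoc', div_lt_iff₀ (hpos x)]
    nlinarith [hεpos x hx]

theorem finite_inter_closedBall_of_not_accPt {n : ℕ} {E : Set (Fin n → ℂ)}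
    (hE : ∀ z : Fin n → ℂ, ¬ AccPt z (𝓟 E)) (r : ℝ) :
    (E ∩ Metric.closedBall 0 r).Finite := by
  by_contra hinf
  obtain ⟨x, -, hx⟩ := Set.Infinite.exists_accPt_of_subset_isCompact hinf
    (isCompact_closedBall (0 : Fin n → ℂ) r) inter_subset_right
  exact hE x (hx.mono (principal_mono.2 inter_subset_left))

theorem countable_of_finite_inter_closedBall {n : ℕ} {E : Set (Fin n → ℂ)}
    (hE : ∀ r : ℝ, (E ∩ Metric.closedBall 0 r).Finite) : E.Countable := by
  refine (countable_iUnion fun k : ℕ => (hE k).countable).mono fun z hz => ?_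
  obtain ⟨k, hk⟩ := exists_nat_ge ‖z‖
  exact mem_iUnion.2 ⟨k, hz, mem_closedBall_zero_iff.2 hk⟩

/-- adding a closed discrete set disjoint from a Carleman continuum
yields a Carleman continuum, with interpolation on the discrete set. -/
theorem carleman_union_discrete_with_interpolation {n : ℕ}
    (M E : Set (Fin n → ℂ)) (hMclosed : IsClosed M) (hMcar : IsCarleman M)
    (hEclosed : IsClosed E)
    (hEdisc : ∀ z : Fin n → ℂ, ¬ AccPt z (Filter.principal E))
    (hdisj : Disjoint E M)
    (q : (Fin n → ℂ) → ℂ) (hq : ContinuousOn q (M ∪ E))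
    (ε : (Fin n → ℂ) → ℝ) (hε : ContinuousOn ε (M ∪ E))
    (hεpos : ∀ x ∈ M ∪ E, 0 < ε x) :
    ∃ g : (Fin n → ℂ) → ℂ, Differentiable ℂ g ∧
      (∀ x ∈ M ∪ E, ‖g x - q x‖ < ε x) ∧ (∀ z ∈ E, g z = q z) := by
  obtain ⟨g₀, hg₀, hg₀M⟩ := hMcar q (hq.mono subset_union_left) (fun x => ε x / 2)
    ((hε.mono subset_union_left).div_const 2) fun x hx => half_pos (hεpos x (Or.inl hx))
  rcases E.eq_empty_or_nonempty with rfl | hne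
  · refine ⟨g₀, hg₀, fun x hx => ?_, fun z hz => hz.elim⟩
    have hxM : x ∈ M := by simpa using hx
    exact (hg₀M x hxM).trans (half_lt_self (hεpos x hx))
  have hfin := finite_inter_closedBall_of_not_accPt hEdisc
  obtain ⟨P, hP, hPE⟩ := exists_differentiable_common_zeros E hfin hne
    (countable_of_finite_inter_closedBall hfin)
  obtain ⟨F, hF, hFE⟩ := exists_differentiable_interpolating E hfin fun z => q z - g₀ z
  have hPM : ∀ x ∈ M, ∃ i, P i x ≠ 0 := by
    intro x hx
    by_contra! hcon
    exact disjoint_left.1 hdisj ((hPE x).2 hcon) hx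
  have hFpos : ∀ x, 0 < 1 + ‖F x‖ := fun x => by positivity
  obtain ⟨G, hG, hG1, hGM⟩ := hMcar.exists_small_eq_one hP hPM
    (ε := fun x => ε x / 2 / (1 + ‖F x‖))
    (((hε.mono subset_union_left).div_const 2).div
      (by have := hF.continuous; fun_prop) fun x _ => (hFpos x).ne')
    fun x hx => div_pos (half_pos (hεpos x (Or.inl hx))) (hFpos x)
  have hinterp : ∀ z ∈ E, g₀ z + F z * G z = q z := by
    intro z hz
    rw [hG1 z ((hPE z).1 hz), hFE z hz]
    ring
  refine ⟨fun z => g₀ z + F z * G z, hg₀.add (hF.mul hG), ?_, hinterp⟩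
  rintro x (hx | hx)
  · have hsmall : ‖F x * G x‖ ≤ ε x / 2 := by
      have hGx := hGM x hx
      rw [lt_div_iff₀ (hFpos x)] at hGx
      rw [norm_mul]
      nlinarith [norm_nonneg (G x)]
    have htri := norm_add_le (g₀ x - q x) (F x * G x)
    have hg₀x := hg₀M x hx
    have heq : g₀ x + F x * G x - q x = g₀ x - q x + F x * G x := by ring
    change ‖g₀ x + F x * G x - q x‖ < ε x
    rw [heq]
    linarith
  · change ‖g₀ x + F x * G x - q x‖ < ε x
    rw [hinterp x hx, sub_self, norm_zero]
    exact hεpos x (Or.inr hx)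
end
end

section
/- Let M ⊆ ℂⁿ be a closed set which is a Carleman continuum, and let x : ℕ → ℂⁿ be an injective sequence whose image E is a closed discrete subset of ℂⁿ contained in ℂⁿ \ M. Then there exists an entire function q on ℂⁿ such that |q(z)| < 1/2 for all z ∈ M and q(x_j) = j for all j ∈ ℕ. -/
open Set

noncomputable section

section Interpolation

variable {E : Type*} [NormedAddCommGroup E] [NormedSpace ℂ E]

theorem exists_contDiff_eq_zero_of_lt_eq {x : ℕ → E} (hinj : Function.Injective x) (j : ℕ)
    (c : ℂ) : ∃ p : E → ℂ, ContDiff ℂ 1 p ∧ (∀ k < j, p (x k) = 0) ∧ p (x j) = c := by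
  have hsep : ∀ k : ℕ, ∃ f : E →L[ℂ] ℂ, k ≠ j → f (x j - x k) ≠ 0 := by
    intro k
    by_cases hk : k = j
    · exact ⟨0, fun h => absurd hk h⟩
    · obtain ⟨f, hf⟩ := SeparatingDual.exists_ne_zero (R := ℂ)
        (sub_ne_zero.2 (fun h => hk (hinj h).symm) : x j - x k ≠ 0)
      exact ⟨f, fun _ => hf⟩
  choose f hf using hsep
  have hne : ∏ k ∈ Finset.range j, f k (x j - x k) ≠ 0 :=
    Finset.prod_ne_zero_iff.2 fun k hk => hf k (Finset.mem_range.1 hk).ne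
  refine ⟨fun z => c * (∏ k ∈ Finset.range j, f k (x j - x k))⁻¹ *
    ∏ k ∈ Finset.range j, f k (z - x k), ?_, fun k hk => ?_, ?_⟩
  · refine contDiff_const.mul (contDiff_prod fun k _ => ?_)
    exact (f k).contDiff.comp (contDiff_id.sub contDiff_const)
  · exact mul_eq_zero_of_right _ (Finset.prod_eq_zero (Finset.mem_range.2 hk) (by simp))
  · field_simp

theorem exists_contDiff_small_on_half_ball [ProperSpace E] {x : ℕ → E}
    (hinj : Function.Injective x) (j : ℕ) (c : ℂ) {ε : ℝ} (hε : 0 < ε) :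
    ∃ t : E → ℂ, ContDiff ℂ 1 t ∧ (∀ k < j, t (x k) = 0) ∧ t (x j) = c ∧
      ∀ z, ‖z‖ < ‖x j‖ / 2 → ‖t z‖ ≤ ε ∧ ‖fderiv ℂ t z‖ ≤ ε := by
  obtain ⟨p, hp, hp0, hpj⟩ := exists_contDiff_eq_zero_of_lt_eq hinj j c
  rcases eq_or_ne (x j) 0 with hx | hx
  · refine ⟨p, hp, hp0, hpj, fun z hz => ?_⟩
    rw [hx, norm_zero, zero_div] at hz
    exact absurd hz (norm_nonneg z).not_gt
  have hxn : 0 < ‖x j‖ := norm_pos_iff.2 hx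
  obtain ⟨g, hg, hgx⟩ := exists_dual_vector ℂ (x j) hxn.ne'
  have hgz : ∀ z, ‖z‖ < ‖x j‖ / 2 → ‖(‖x j‖ : ℂ)⁻¹ * g z‖ ≤ 1 / 2 := by
    intro z hz
    have h1 : ‖g z‖ ≤ ‖z‖ := by simpa [hg] using g.le_opNorm z
    rw [norm_mul, norm_inv, Complex.norm_real, norm_norm, inv_mul_le_iff₀ hxn]
    linarith
  set l : E →L[ℂ] ℂ := (‖x j‖ : ℂ)⁻¹ • g with hl
  have hlj : l (x j) = 1 := by
    have : (‖x j‖ : ℂ) ≠ 0 := by exact_mod_cast hxn.ne'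
    simp [hl, hgx, this]
  have hlz : ∀ z, ‖z‖ < ‖x j‖ / 2 → ‖l z‖ ≤ 1 / 2 := hgz
  obtain ⟨B₁, hB₁⟩ := (isCompact_closedBall (0 : E) ‖x j‖).exists_bound_of_continuousOn
    hp.continuous.continuousOn
  obtain ⟨B₂, hB₂⟩ := (isCompact_closedBall (0 : E) ‖x j‖).exists_bound_of_continuousOn
    (hp.continuous_fderiv one_ne_zero).continuousOn
  have hmem : ∀ z : E, ‖z‖ < ‖x j‖ / 2 → z ∈ Metric.closedBall (0 : E) ‖x j‖ := fun z hz => by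
    rw [mem_closedBall_zero_iff]; linarith
  have hpow : Filter.Tendsto (fun m : ℕ => (1 / 2 : ℝ) ^ (m + 1)) Filter.atTop (nhds 0) :=
    (tendsto_pow_atTop_nhds_zero_of_lt_one (by norm_num) (by norm_num)).comp
      (Filter.tendsto_add_atTop_nat 1)
  have hmpow : Filter.Tendsto (fun m : ℕ => ((m + 1 : ℕ) : ℝ) * (1 / 2 : ℝ) ^ (m + 1))
      Filter.atTop (nhds 0) :=
    (tendsto_self_mul_const_pow_of_lt_one (by norm_num) (by norm_num)).comp
      (Filter.tendsto_add_atTop_nat 1)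
  have hval : ∀ᶠ m : ℕ in Filter.atTop, (1 / 2 : ℝ) ^ (m + 1) * B₁ < ε := by
    have := hpow.mul_const B₁
    rw [zero_mul] at this
    exact this.eventually_lt_const hε
  have hder : ∀ᶠ m : ℕ in Filter.atTop, (1 / 2 : ℝ) ^ (m + 1) * B₂ +
      (((m + 1 : ℕ) : ℝ) * (1 / 2 : ℝ) ^ (m + 1)) * (2 * ‖l‖ * B₁) < ε := by
    have := (hpow.mul_const B₂).add (hmpow.mul_const (2 * ‖l‖ * B₁))
    rw [zero_mul, zero_mul, add_zero] at this
    exact this.eventually_lt_const hε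
  obtain ⟨m, hm₁, hm₂⟩ := (hval.and hder).exists
  refine ⟨fun z => l z ^ (m + 1) * p z, (l.contDiff.pow _).mul hp,
    fun k hk => by simp [hp0 k hk], by simp [hlj, hpj], fun z hz => ⟨?_, ?_⟩⟩
  · rw [norm_mul, norm_pow]
    refine le_trans ?_ hm₁.le
    gcongr
    · exact hlz z hz
    · exact hB₁ z (hmem z hz)
  · have hd := (l.hasFDerivAt (x := z)).pow (m + 1) |>.fun_mul
      (hp.differentiable one_ne_zero z).hasFDerivAt
    rw [HasFDerivAt.fderiv hd]
    refine le_trans (norm_add_le _ _) (le_trans ?_ hm₂.le)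
    have hB₁0 : 0 ≤ B₁ := (norm_nonneg _).trans (hB₁ z (hmem z hz))
    refine add_le_add ?_ ?_
    · rw [norm_smul, norm_pow]
      gcongr
      · exact hlz z hz
      · exact hB₂ z (hmem z hz)
    · simp only [norm_smul, norm_pow, Nat.add_sub_cancel, nsmul_eq_mul, norm_mul,
        Complex.norm_natCast]
      calc ‖p z‖ * (((m + 1 : ℕ) : ℝ) * ‖l z‖ ^ m * ‖l‖)
          ≤ B₁ * (((m + 1 : ℕ) : ℝ) * (1 / 2) ^ m * ‖l‖) := by
            gcongr
            · exact hB₁ z (hmem z hz)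
            · exact hlz z hz
        _ = _ := by ring

theorem exists_sequence_eq_of_previous (F : (j : ℕ) → ((k : ℕ) → k < j → ℂ) → ℂ) :
    ∃ c : ℕ → ℂ, ∀ j, c j = F j fun k _ => c k :=
  ⟨Nat.lt_wfRel.wf.fix F, fun j => Nat.lt_wfRel.wf.fix_eq F j⟩

theorem exists_differentiable_interpolation [ProperSpace E] {x : ℕ → E}
    (hinj : Function.Injective x)
    (hx : Filter.Tendsto (fun j => ‖x j‖) Filter.atTop Filter.atTop) (a : ℕ → ℂ) :
    ∃ h : E → ℂ, Differentiable ℂ h ∧ ∀ j, h (x j) = a j := by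
  choose T hTd hT0 hTj hTs using fun (j : ℕ) (c : ℂ) =>
    exists_contDiff_small_on_half_ball hinj j c (ε := (1 / 2) ^ j) (by positivity)
  obtain ⟨c, hc⟩ := exists_sequence_eq_of_previous
    fun j c => a j - ∑ k : Fin j, T k (c k k.2) (x j)
  have hfar : ∀ R : ℝ, ∀ᶠ j in Filter.atTop, ∀ z ∈ Metric.ball (0 : E) R,
      ‖T j (c j) z‖ ≤ (1 / 2) ^ j ∧ ‖fderiv ℂ (T j (c j)) z‖ ≤ (1 / 2) ^ j := by
    intro R
    filter_upwards [hx.eventually_ge_atTop (2 * R)] with j hj z hz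
    refine hTs j (c j) z ?_
    rw [mem_ball_zero_iff] at hz
    linarith
  have hgeom : Summable fun j : ℕ => (1 / 2 : ℝ) ^ j := summable_geometric_two
  refine ⟨fun z => ∑' j, T j (c j) z, fun z => ?_, fun j => ?_⟩
  · set R := ‖z‖ + 1
    have hz : z ∈ Metric.ball (0 : E) R := by simp [R]
    have hbound : ∀ j, ∃ u : ℝ, (∀ w ∈ Metric.ball (0 : E) R, ‖fderiv ℂ (T j (c j)) w‖ ≤ u) ∧
        ((∀ w ∈ Metric.ball (0 : E) R, ‖fderiv ℂ (T j (c j)) w‖ ≤ (1 / 2) ^ j) →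
          u = (1 / 2) ^ j) := by
      intro j
      by_cases h : ∀ w ∈ Metric.ball (0 : E) R, ‖fderiv ℂ (T j (c j)) w‖ ≤ (1 / 2) ^ j
      · exact ⟨_, h, fun _ => rfl⟩
      · obtain ⟨u, hu⟩ := (isCompact_closedBall (0 : E) R).exists_bound_of_continuousOn
          ((hTd j (c j)).continuous_fderiv one_ne_zero).continuousOn
        exact ⟨u, fun w hw => hu w (Metric.ball_subset_closedBall hw), fun h' => absurd h' h⟩
    choose u hu hu' using hbound
    have hus : Summable u := by
      refine (summable_congr_atTop ?_).2 hgeom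
      filter_upwards [hfar R] with j hj
      exact hu' j fun w hw => (hj w hw).2
    have hzs : Summable fun j => T j (c j) z := by
      refine Summable.of_norm_bounded_eventually_nat hgeom ?_
      filter_upwards [hfar R] with j hj
      exact (hj z hz).1
    exact (hasFDerivAt_tsum_of_isPreconnected hus Metric.isOpen_ball
      (convex_ball (0 : E) R).isPreconnected
      (fun j w _ => ((hTd j (c j)).differentiable one_ne_zero w).hasFDerivAt)
      (fun j w hw => hu j w hw) hz hzs hz).differentiableAt
  · have hzero : ∀ k ∉ Finset.range (j + 1), T k (c k) (x j) = 0 := fun k hk =>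
      hT0 k (c k) j (by simpa using hk)
    simp only
    rw [tsum_eq_sum hzero, Finset.sum_range_succ, hTj, hc j, Finset.sum_range]
    ring

end Interpolation

theorem tendsto_norm_atTop_of_injective_of_not_accPt {E : Type*} [NormedAddCommGroup E]
    [ProperSpace E] {x : ℕ → E} (hinj : Function.Injective x)
    (hdisc : ∀ z, ¬ AccPt z (Filter.principal (Set.range x))) :
    Filter.Tendsto (fun j => ‖x j‖) Filter.atTop Filter.atTop := by
  rw [← Nat.cofinite_eq_atTop, Filter.tendsto_atTop]
  intro R
  rw [Filter.eventually_cofinite]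
  by_contra hinf
  have himg : (x '' {j | ¬ R ≤ ‖x j‖}).Infinite := Set.Infinite.image hinj.injOn hinf
  obtain ⟨z, -, hz⟩ := himg.exists_accPt_of_subset_isCompact (isCompact_closedBall (0 : E) R) (by
    rintro _ ⟨j, hj, rfl⟩
    rw [mem_closedBall_zero_iff]
    exact (not_le.1 hj).le)
  exact hdisc z (hz.mono (Filter.principal_mono.2 (Set.image_subset_range _ _)))

/-- A closed discrete sequence in `ℂⁿ` is the common zero set of `n + 1` entire functions. -/
theorem exists_differentiable_common_zeros_eq_range {n : ℕ} {x : ℕ → (Fin n → ℂ)}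
    (hinj : Function.Injective x)
    (hx : Filter.Tendsto (fun j => ‖x j‖) Filter.atTop Filter.atTop) :
    ∃ F : Option (Fin n) → (Fin n → ℂ) → ℂ, (∀ i, Differentiable ℂ (F i)) ∧
      ∀ z, (∀ i, F i z = 0) ↔ z ∈ Set.range x := by
  obtain ⟨h, hd, hj⟩ := exists_differentiable_interpolation hinj hx fun j => (j : ℂ)
  have hcast : Filter.Tendsto (fun j : ℕ => ‖(j : ℂ)‖) Filter.atTop Filter.atTop := by
    simpa using tendsto_natCast_atTop_atTop (R := ℝ)
  choose P hPd hPj using fun i : Fin n =>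
    exists_differentiable_interpolation Nat.cast_injective hcast fun j => x j i
  refine ⟨fun o => o.elim (fun z => (Complex.Gamma (-h z))⁻¹) fun i z => z i - P i (h z),
    ?_, fun z => ⟨fun hz => ?_, ?_⟩⟩
  · rintro (_ | i)
    · exact Complex.differentiable_one_div_Gamma.comp hd.neg
    · exact (differentiable_apply i).sub ((hPd i).comp hd)
  · obtain ⟨m, hm⟩ := (Complex.Gamma_eq_zero_iff _).1 (inv_eq_zero.1 (hz none))
    refine ⟨m, funext fun i => ?_⟩
    have hi : z i - P i (h z) = 0 := hz (some i)
    rw [neg_inj.1 hm, hPj] at hi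
    exact (sub_eq_zero.1 hi).symm
  · rintro ⟨j, rfl⟩ (_ | i)
    · simp [hj, Complex.Gamma_neg_nat_eq_zero]
    · simp [hj, hPj]

theorem IsCarleman.exists_differentiable_small_eq_one {n : ℕ} {M : Set (Fin n → ℂ)}
    (hM : IsCarleman M) {ι : Type*} [Fintype ι] {F : ι → (Fin n → ℂ) → ℂ}
    (hF : ∀ i, Differentiable ℂ (F i)) (hFM : ∀ z ∈ M, ∃ i, F i z ≠ 0)
    {ε : (Fin n → ℂ) → ℝ} (hε : Continuous ε) (hε0 : ∀ z, 0 < ε z) :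
    ∃ q : (Fin n → ℂ) → ℂ, Differentiable ℂ q ∧ (∀ z ∈ M, ‖q z‖ < ε z) ∧
      ∀ z, (∀ i, F i z = 0) → q z = 1 := by
  set S : (Fin n → ℂ) → ℝ := fun z => ∑ i, ‖F i z‖ with hS
  have hSc : Continuous S := continuous_finsetSum _ fun i _ => (hF i).continuous.norm
  have hS0 : ∀ z, 0 ≤ S z := fun z => Finset.sum_nonneg fun i _ => norm_nonneg _
  set D : (Fin n → ℂ) → ℂ := fun z => ∑ i, F i z * (starRingEnd ℂ) (F i z) with hD
  have hDc : Continuous D := continuous_finsetSum _ fun i _ =>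
    (hF i).continuous.mul (Complex.continuous_conj.comp (hF i).continuous)
  have hD0 : ∀ z ∈ M, D z ≠ 0 := by
    intro z hz h0
    obtain ⟨i, hi⟩ := hFM z hz
    have hre : ∑ i, Complex.normSq (F i z) = 0 := by
      have : ((∑ i, Complex.normSq (F i z) : ℝ) : ℂ) = 0 := by
        simpa [hD, Complex.mul_conj] using h0
      exact_mod_cast this
    rw [Finset.sum_eq_zero_iff_of_nonneg fun i _ => Complex.normSq_nonneg _] at hre
    exact hi (Complex.normSq_eq_zero.1 (hre i (Finset.mem_univ i)))
  choose g hgd hg using fun i : ι => hM (fun z => (starRingEnd ℂ) (F i z) / D z)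
    ((Complex.continuous_conj.comp (hF i).continuous).continuousOn.div hDc.continuousOn hD0)
    (fun z => ε z / (S z + 1))
    (hε.div (hSc.add continuous_const) fun z =>
      (add_pos_of_nonneg_of_pos (hS0 z) one_pos).ne').continuousOn
    (fun z _ => div_pos (hε0 z) (by linarith [hS0 z]))
  refine ⟨fun z => 1 - ∑ i, F i z * g i z, ?_, fun z hz => ?_, fun z hz => by simp [hz]⟩
  · exact (differentiable_const _).sub
      (Differentiable.fun_sum fun i _ => (hF i).mul (hgd i))
  · have hone : (1 : ℂ) = ∑ i, F i z * ((starRingEnd ℂ) (F i z) / D z) := by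
      simp_rw [← mul_div_assoc, ← Finset.sum_div]
      exact (div_self (hD0 z hz)).symm
    have hS1 : 0 < S z + 1 := by linarith [hS0 z]
    calc ‖1 - ∑ i, F i z * g i z‖
        = ‖∑ i, F i z * (g i z - (starRingEnd ℂ) (F i z) / D z)‖ := by
          simp_rw [mul_sub]
          rw [Finset.sum_sub_distrib, ← hone, norm_sub_rev]
      _ ≤ ∑ i, ‖F i z‖ * (ε z / (S z + 1)) := by
          refine norm_sum_le_of_le _ fun i _ => ?_
          rw [norm_mul]
          exact mul_le_mul_of_nonneg_left (hg i z hz).le (norm_nonneg _)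
      _ = S z * (ε z / (S z + 1)) := by rw [← Finset.sum_mul]
      _ < (S z + 1) * (ε z / (S z + 1)) :=
          mul_lt_mul_of_pos_right (lt_add_one _) (div_pos (hε0 z) hS1)
      _ = ε z := mul_div_cancel₀ _ hS1.ne'

/-- an entire function small on a Carleman continuum and unbounded along
a closed discrete sequence disjoint from it. -/
theorem entire_small_on_carleman_large_on_sequence {n : ℕ}
    (M : Set (Fin n → ℂ)) (hMclosed : IsClosed M) (hMcar : IsCarleman M)
    (x : ℕ → (Fin n → ℂ)) (hinj : Function.Injective x)
    (hclosed : IsClosed (Set.range x))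
    (hdisc : ∀ z : Fin n → ℂ, ¬ AccPt z (Filter.principal (Set.range x)))
    (hdisjM : Set.range x ⊆ Mᶜ) :
    ∃ q : (Fin n → ℂ) → ℂ, Differentiable ℂ q ∧
      (∀ z ∈ M, ‖q z‖ < 1/2) ∧ (∀ j : ℕ, q (x j) = (j : ℂ)) := by
  have hx := tendsto_norm_atTop_of_injective_of_not_accPt hinj hdisc
  obtain ⟨h, hd, hj⟩ := exists_differentiable_interpolation hinj hx fun j => (j : ℂ)
  obtain ⟨F, hFd, hF⟩ := exists_differentiable_common_zeros_eq_range hinj hx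
  have hpos : ∀ z, 0 < ‖h z‖ + 1 := fun z => by positivity
  obtain ⟨q, hqd, hqM, hq⟩ := hMcar.exists_differentiable_small_eq_one hFd
    (fun z hz => by
      by_contra! hall
      exact hdisjM ((hF z).1 hall) hz)
    (ε := fun z => 1 / 2 / (‖h z‖ + 1))
    (continuous_const.div (hd.continuous.norm.add continuous_const) fun z => (hpos z).ne')
    (fun z => div_pos one_half_pos (hpos z))
  refine ⟨fun z => h z * q z, hd.mul hqd, fun z hz => ?_, fun j => ?_⟩
  · have hlt := (lt_div_iff₀ (hpos z)).1 (hqM z hz)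
    rw [norm_mul]
    nlinarith [norm_nonneg (q z)]
  · simp only
    rw [hq (x j) ((hF (x j)).2 ⟨j, rfl⟩), hj, mul_one]
end
end

section
/- For j = 1, 2, let M_j ⊆ ℂ^{n_j} be a closed set which is a Carleman continuum, and assume each M_j has the following approximation property: for every compact set K ⊆ ℂ^{n_j} with K ∪ M_j polynomially convex, every continuous function on K ∪ M_j that is holomorphic on an open neighborhood of K, and every continuous ε : K ∪ M_j → (0,∞), there is an entire function g on ℂ^{n_j} with |g − f| < ε on K ∪ M_j. For j = 1, 2, let K̃_j ⊆ ℂ^{n_j} be compact and set K_j := K̃_j ∪ closure(h(K̃_j ∪ M_j)) (a compact set, since M_j, being a Carleman continuum, has bounded E-hulls). Then the closed set (K₁ × K₂) ∪ (M₁ × M₂) ⊆ ℂ^{n₁} × ℂ^{n₂} = ℂ^{n₁+n₂} is polynomially convex. -/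
open Set

noncomputable section

/-- The product of `M₁ ⊆ ℂ^{n₁}` and `M₂ ⊆ ℂ^{n₂}` viewed inside `ℂ^{n₁+n₂}`
via the standard identification `ℂ^{n₁} × ℂ^{n₂} = ℂ^{n₁+n₂}`. -/
def prodSet {n₁ n₂ : ℕ} (M₁ : Set (Fin n₁ → ℂ)) (M₂ : Set (Fin n₂ → ℂ)) :
    Set (Fin (n₁ + n₂) → ℂ) :=
  {z | (fun i => z (Fin.castAdd n₂ i)) ∈ M₁ ∧ (fun i => z (Fin.natAdd n₁ i)) ∈ M₂}

/-- The approximation property of Theorem 3: Carleman approximation of functions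
continuous on `K ∪ M` and holomorphic near `K`, whenever `K ∪ M` is polynomially convex. -/
def ApproxProp {n : ℕ} (M : Set (Fin n → ℂ)) : Prop :=
  ∀ K : Set (Fin n → ℂ), IsCompact K → IsPolyConvex (K ∪ M) →
  ∀ f : (Fin n → ℂ) → ℂ, ContinuousOn f (K ∪ M) →
  (∃ U : Set (Fin n → ℂ), IsOpen U ∧ K ⊆ U ∧ DifferentiableOn ℂ f U) →
  ∀ ε : (Fin n → ℂ) → ℝ, ContinuousOn ε (K ∪ M) → (∀ x ∈ K ∪ M, 0 < ε x) →
  ∃ g : (Fin n → ℂ) → ℂ, Differentiable ℂ g ∧ ∀ x ∈ K ∪ M, ‖g x - f x‖ < ε x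

theorem cauchyIntegral_eq_of_separating {P : Type*} [NormedAddCommGroup P] [NormedSpace ℂ P]
    [CompleteSpace P] {G : ℂ → P} (hG : Continuous G) (S : Set (P →L[ℂ] ℂ))
    (hS : ∀ a b : P, (∀ L ∈ S, L a = L b) → a = b)
    (hdiff : ∀ L ∈ S, Differentiable ℂ fun z => L (G z)) {R : ℝ} {w : ℂ}
    (hw : w ∈ Metric.ball (0 : ℂ) R) :
    (2 * (Real.pi : ℂ) * Complex.I)⁻¹ • (∮ z in C(0, R), (z - w)⁻¹ • G z) = G w := by
  have hR : 0 < R := Metric.pos_of_mem_ball hw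
  refine hS _ _ fun L hL => ?_
  have h1 := DiffContOnCl.two_pi_i_inv_smul_circleIntegral_sub_inv_smul
    (hdiff L hL).diffContOnCl hw
  rw [← h1, map_smul]
  congr 1
  have hci : CircleIntegrable (fun z => (z - w)⁻¹ • G z) 0 R := by
    refine ContinuousOn.circleIntegrable hR.le ?_
    refine ContinuousOn.smul (ContinuousOn.inv₀ (by fun_prop) ?_) hG.continuousOn
    intro z hz h
    rw [sub_eq_zero.1 h] at hz
    simp only [Metric.mem_sphere, Metric.mem_ball] at hz hw
    exact hw.ne hz
  simp only [circleIntegral]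
  rw [← L.intervalIntegral_comp_comm hci.out]
  simp

theorem exists_polynomial_approx {n : ℕ} {F : (Fin n → ℂ) → ℂ} (hF : Differentiable ℂ F)
    (R : ℝ) {ε : ℝ} (hε : 0 < ε) :
    ∃ p : MvPolynomial (Fin n) ℂ, ∀ z, ‖z‖ ≤ R → ‖F z - MvPolynomial.eval z p‖ ≤ ε := by
  induction n generalizing ε with
  | zero =>
    refine ⟨MvPolynomial.C (F 0), fun z _ => ?_⟩
    rw [Subsingleton.elim z 0]
    simpa using hε.le
  | succ n ih =>
    set K : Set (Fin n → ℂ) := Metric.closedBall 0 R with hK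
    have : CompactSpace K := isCompact_iff_compactSpace.1 (isCompact_closedBall 0 R)
    let ev : MvPolynomial (Fin n) ℂ →ₗ[ℂ] C(K, ℂ) :=
      { toFun := fun p => ⟨fun z => MvPolynomial.eval z.1 p,
          (MvPolynomial.continuous_eval p).comp continuous_subtype_val⟩
        map_add' := fun p q => by ext; simp
        map_smul' := fun c p => by ext; simp }
    let P : Submodule ℂ C(K, ℂ) := (LinearMap.range ev).topologicalClosure
    have : CompleteSpace P := (Submodule.isClosed_topologicalClosure _).completeSpace_coe
    have hPapprox : ∀ a ∈ P, ∀ η : ℝ, 0 < η → ∃ q : MvPolynomial (Fin n) ℂ, ‖a - ev q‖ < η := by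
      intro a ha η hη
      obtain ⟨_, ⟨q, rfl⟩, hq⟩ := Metric.mem_closure_iff.1 ha η hη
      exact ⟨q, by rwa [← dist_eq_norm]⟩
    have hcons : Differentiable ℂ fun x : ℂ × (Fin n → ℂ) => (Fin.cons x.1 x.2 : Fin (n + 1) → ℂ) := by
      rw [differentiable_pi]
      intro i
      refine Fin.cases ?_ (fun j => ?_) i
      · simp
      · simp only [Fin.cons_succ]
        fun_prop
    let g : C(ℂ × K, ℂ) := ⟨fun x => F (Fin.cons x.1 x.2.1),
      hF.continuous.comp (hcons.continuous.comp
        (by fun_prop : Continuous fun x : ℂ × K => (x.1, (x.2 : Fin n → ℂ))))⟩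
    have hgP : ∀ ζ, g.curry ζ ∈ P := by
      intro ζ
      refine Metric.mem_closure_iff.2 fun η hη => ?_
      obtain ⟨p, hp⟩ := ih (F := fun w => F (Fin.cons ζ w))
        (hF.comp (hcons.comp (by fun_prop : Differentiable ℂ fun w : Fin n → ℂ => (ζ, w))))
        (half_pos hη)
      refine ⟨ev p, ⟨p, rfl⟩, lt_of_le_of_lt ?_ (half_lt_self hη)⟩
      rw [dist_eq_norm, ContinuousMap.norm_le _ (half_pos hη).le]
      rintro ⟨w, hw⟩
      exact hp w (by simpa [hK] using hw)
    let G : ℂ → P := fun ζ => ⟨g.curry ζ, hgP ζ⟩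
    have hG : Continuous G := g.curry.continuous.subtype_mk _
    let L : K → P →L[ℂ] ℂ := fun w => (ContinuousMap.evalCLM ℂ w).comp P.subtypeL
    have hLG : ∀ ζ w, L w (G ζ) = F (Fin.cons ζ w.1) := fun ζ w => rfl
    rcases lt_or_ge R 0 with hR | hR
    · exact ⟨0, fun z hz => absurd ((norm_nonneg z).trans hz) (not_le.2 hR)⟩
    obtain ⟨r, hr⟩ : ∃ r : NNReal, (r : ℝ) = R + 2 := ⟨(R + 2).toNNReal, by simp; linarith⟩
    obtain ⟨r', hr'⟩ : ∃ r : NNReal, (r : ℝ) = R + 1 := ⟨(R + 1).toNNReal, by simp; linarith⟩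
    have hcauchy : ∀ w ∈ Metric.ball (0 : ℂ) r,
        (2 * (Real.pi : ℂ) * Complex.I)⁻¹ • (∮ z in C(0, r), (z - w)⁻¹ • G z) = G w := by
      intro w hw
      refine cauchyIntegral_eq_of_separating hG (Set.range L) ?_ ?_ hw
      · intro a b hab
        ext x
        exact hab _ ⟨x, rfl⟩
      · rintro _ ⟨x, rfl⟩
        simp only [hLG]
        exact hF.comp (hcons.comp (by fun_prop : Differentiable ℂ fun ζ : ℂ => (ζ, x.1)))
    have hps := hasFPowerSeriesOn_cauchy_integral (f := G) (c := 0) (R := r)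
      (hG.continuousOn.circleIntegrable r.coe_nonneg)
      (by rw [← NNReal.coe_pos]; linarith)
    set p := cauchyPowerSeries G 0 r with hp
    have hunif := hps.tendstoUniformlyOn (r' := r')
      (by rw [ENNReal.coe_lt_coe, ← NNReal.coe_lt_coe]; linarith)
    obtain ⟨N, hN⟩ := (Metric.tendstoUniformlyOn_iff.1 hunif (ε / 2) (half_pos hε)).exists
    set A : ℝ := ∑ k ∈ Finset.range N, R ^ k with hA
    have hA0 : 0 ≤ A := Finset.sum_nonneg fun k _ => pow_nonneg hR k
    have hq : ∀ k, ∃ q : MvPolynomial (Fin n) ℂ,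
        ‖((p.coeff k : P) : C(K, ℂ)) - ev q‖ < ε / 2 / (A + 1) :=
      fun k => hPapprox _ (p.coeff k).2 _ (by positivity)
    choose q hq using hq
    refine ⟨∑ k ∈ Finset.range N, MvPolynomial.X 0 ^ k * MvPolynomial.rename Fin.succ (q k), ?_⟩
    intro z hz
    have hz0 : ‖z 0‖ ≤ R := (norm_le_pi_norm z 0).trans hz
    have hzt : Fin.tail z ∈ K := by
      rw [hK, mem_closedBall_zero_iff, pi_norm_le_iff_of_nonneg hR]
      exact fun i => (norm_le_pi_norm z i.succ).trans hz
    let w : K := ⟨Fin.tail z, hzt⟩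
    have e1 : F z = (G (z 0)).1 w := by
      change F z = F (Fin.cons (z 0) (Fin.tail z))
      rw [Fin.cons_self_tail]
    have e2 : MvPolynomial.eval z
        (∑ k ∈ Finset.range N, MvPolynomial.X 0 ^ k * MvPolynomial.rename Fin.succ (q k))
        = ∑ k ∈ Finset.range N, z 0 ^ k * ev (q k) w := by
      rw [map_sum]
      refine Finset.sum_congr rfl fun k _ => ?_
      simp only [map_mul, map_pow, MvPolynomial.eval_X, MvPolynomial.eval_rename]
      rfl
    have e3 : ‖(G (z 0)).1 w - ∑ k ∈ Finset.range N, z 0 ^ k * (p.coeff k).1 w‖ ≤ ε / 2 := by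
      have h := hN (z 0) (by rw [mem_ball_zero_iff]; linarith)
      have hw0 : z 0 ∈ Metric.ball (0 : ℂ) r := by
        rw [mem_ball_zero_iff]; linarith
      have hc := hcauchy _ hw0
      rw [zero_add, dist_eq_norm] at h
      change ‖(2 * (Real.pi : ℂ) * Complex.I)⁻¹ •
        (∮ u in C(0, r), (u - z 0)⁻¹ • G u) - _‖ < _ at h
      rw [hc] at h
      refine le_trans ?_ h.le
      have h2 := ContinuousMap.norm_coe_le_norm (G (z 0) - p.partialSum N (z 0)).1 w
      refine le_trans (le_of_eq ?_) h2
      congr 1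
      simp [FormalMultilinearSeries.partialSum]
    have e4 : ‖∑ k ∈ Finset.range N, z 0 ^ k * (p.coeff k).1 w
        - ∑ k ∈ Finset.range N, z 0 ^ k * ev (q k) w‖ ≤ ε / 2 := by
      rw [← Finset.sum_sub_distrib]
      calc _ ≤ ∑ k ∈ Finset.range N, R ^ k * (ε / 2 / (A + 1)) := by
            refine norm_sum_le_of_le _ fun k _ => ?_
            rw [← mul_sub, norm_mul, norm_pow]
            gcongr
            exact (ContinuousMap.norm_coe_le_norm ((p.coeff k).1 - ev (q k)) w).trans (hq k).le
        _ = A * (ε / 2 / (A + 1)) := by rw [Finset.sum_mul]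
        _ ≤ ε / 2 := by
            rw [← mul_div_assoc, div_le_iff₀ (by positivity)]
            nlinarith
    rw [e1, e2]
    calc _ ≤ _ := norm_sub_le_norm_sub_add_norm_sub _ _ _
      _ ≤ ε / 2 + ε / 2 := add_le_add e3 e4
      _ = ε := by ring

section Hulls

variable {n : ℕ}

theorem norm_eval_le_of_mem_polyHullCompact {C : Set (Fin n → ℂ)} {z : Fin n → ℂ}
    (hz : z ∈ polyHullCompact C) (p : MvPolynomial (Fin n) ℂ) {B : ℝ} (hB : 0 ≤ B)
    (h : ∀ w ∈ C, ‖MvPolynomial.eval w p‖ ≤ B) : ‖MvPolynomial.eval z p‖ ≤ B := by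
  refine (hz p).trans (Real.sSup_le ?_ hB)
  rintro _ ⟨w, hw, rfl⟩
  exact h w hw

theorem bddAbove_norm_eval_image {C : Set (Fin n → ℂ)} (hC : IsCompact C)
    (p : MvPolynomial (Fin n) ℂ) :
    BddAbove ((fun w => ‖MvPolynomial.eval w p‖) '' C) :=
  hC.bddAbove_image (MvPolynomial.continuous_eval p).norm.continuousOn

theorem norm_eval_le_sSup {C : Set (Fin n → ℂ)} (hC : IsCompact C)
    (p : MvPolynomial (Fin n) ℂ) {w : Fin n → ℂ} (hw : w ∈ C) :
    ‖MvPolynomial.eval w p‖ ≤ sSup ((fun w => ‖MvPolynomial.eval w p‖) '' C) :=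
  le_csSup (bddAbove_norm_eval_image hC p) ⟨w, hw, rfl⟩

theorem sSup_norm_eval_nonneg (C : Set (Fin n → ℂ)) (p : MvPolynomial (Fin n) ℂ) :
    0 ≤ sSup ((fun w => ‖MvPolynomial.eval w p‖) '' C) := by
  refine Real.sSup_nonneg ?_
  rintro _ ⟨w, _, rfl⟩
  exact norm_nonneg _

theorem subset_polyHullCompact {C : Set (Fin n → ℂ)} (hC : IsCompact C) :
    C ⊆ polyHullCompact C := fun _ hz p => norm_eval_le_sSup hC p hz

theorem polyHullCompact_subset {C D : Set (Fin n → ℂ)}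
    (h : C ⊆ polyHullCompact D) : polyHullCompact C ⊆ polyHullCompact D := fun _ hz p =>
  norm_eval_le_of_mem_polyHullCompact hz p (sSup_norm_eval_nonneg D p) fun _ hw => h hw p

theorem isClosed_polyHullCompact (C : Set (Fin n → ℂ)) : IsClosed (polyHullCompact C) := by
  have : polyHullCompact C = ⋂ p : MvPolynomial (Fin n) ℂ, {z | ‖MvPolynomial.eval z p‖ ≤
      sSup ((fun w => ‖MvPolynomial.eval w p‖) '' C)} := by
    ext z
    simp [polyHullCompact]
  rw [this]
  exact isClosed_iInter fun p =>
    isClosed_le (MvPolynomial.continuous_eval p).norm continuous_const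

theorem isCompact_polyHullCompact {C : Set (Fin n → ℂ)} (hC : IsCompact C) :
    IsCompact (polyHullCompact C) := by
  obtain ⟨R, hR⟩ := hC.isBounded.exists_norm_le
  refine (isCompact_closedBall (0 : Fin n → ℂ) (max R 0)).of_isClosed_subset
    (isClosed_polyHullCompact C) fun z hz => ?_
  rw [mem_closedBall_zero_iff, pi_norm_le_iff_of_nonneg (le_max_right _ _)]
  intro i
  have := norm_eval_le_of_mem_polyHullCompact hz (MvPolynomial.X i) (le_max_right R 0)
    fun _ hw => by
      simpa using Or.inl ((norm_le_pi_norm _ i).trans (hR _ hw))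
  simpa using this

/-- Entire functions obey the same estimates on the hull as polynomials. -/
theorem norm_le_of_mem_polyHullCompact {C : Set (Fin n → ℂ)} (hC : IsCompact C)
    {z : Fin n → ℂ} (hz : z ∈ polyHullCompact C) {F : (Fin n → ℂ) → ℂ}
    (hF : Differentiable ℂ F) {B : ℝ} (hB : 0 ≤ B) (h : ∀ w ∈ C, ‖F w‖ ≤ B) : ‖F z‖ ≤ B := by
  refine le_of_forall_pos_le_add fun ε hε => ?_
  obtain ⟨R, hR⟩ := hC.isBounded.exists_norm_le
  obtain ⟨p, hp⟩ := exists_polynomial_approx hF (max R ‖z‖) (half_pos hε)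
  have h1 : ‖MvPolynomial.eval z p‖ ≤ B + ε / 2 := by
    refine norm_eval_le_of_mem_polyHullCompact hz p (by positivity) fun w hw => ?_
    have h2 := hp w ((hR w hw).trans (le_max_left _ _))
    have h3 := norm_le_norm_add_norm_sub (F w) (MvPolynomial.eval w p)
    linarith [h w hw]
  have h2 := hp z (le_max_right _ _)
  have h3 := norm_le_norm_add_norm_sub (MvPolynomial.eval z p) (F z)
  rw [norm_sub_rev] at h3
  linarith

theorem exists_eval_eq_one_of_notMem_polyHullCompact {C : Set (Fin n → ℂ)} (hC : IsCompact C)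
    {x : Fin n → ℂ} (hx : x ∉ polyHullCompact C) {η : ℝ} (hη : 0 < η) :
    ∃ p : MvPolynomial (Fin n) ℂ, MvPolynomial.eval x p = 1 ∧
      ∀ w ∈ C, ‖MvPolynomial.eval w p‖ ≤ η := by
  simp only [polyHullCompact, Set.mem_ofPred_eq, not_forall, not_le] at hx
  obtain ⟨p, hp⟩ := hx
  set s := sSup ((fun w => ‖MvPolynomial.eval w p‖) '' C) with hs
  have hs0 : 0 ≤ s := sSup_norm_eval_nonneg C p
  have hpx : 0 < ‖MvPolynomial.eval x p‖ := hs0.trans_lt hp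
  obtain ⟨k, hk⟩ := exists_pow_lt_of_lt_one hη ((div_lt_one hpx).2 hp)
  refine ⟨(MvPolynomial.C (MvPolynomial.eval x p)⁻¹ * p) ^ k, ?_, fun w hw => ?_⟩
  · simp [norm_pos_iff.1 hpx]
  · refine le_trans ?_ hk.le
    simp only [map_pow, map_mul, MvPolynomial.eval_C, norm_pow, norm_mul, norm_inv]
    rw [inv_mul_eq_div]
    gcongr
    exact norm_eval_le_sSup hC p hw

end Hulls

section Carleman

variable {n : ℕ} {M : Set (Fin n → ℂ)}

theorem sum_mul_star_div {z x : Fin n → ℂ} (h : z ≠ x) :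
    ∑ k, (z k - x k) * (star (z k - x k) / ∑ i, (z i - x i) * star (z i - x i)) = 1 := by
  simp only [← mul_div_assoc]
  rw [← Finset.sum_div, div_self]
  intro h0
  have h1 : ∀ i, (z i - x i) * star (z i - x i) = ((Complex.normSq (z i - x i) : ℝ) : ℂ) :=
    fun i => Complex.mul_conj _
  simp only [h1] at h0
  rw [← Complex.ofReal_sum, Complex.ofReal_eq_zero,
    Finset.sum_eq_zero_iff_of_nonneg fun i _ => Complex.normSq_nonneg _] at h0
  exact h (funext fun i => sub_eq_zero.1 (Complex.normSq_eq_zero.1 (h0 i (Finset.mem_univ i))))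

theorem continuousOn_star_div {x : Fin n → ℂ} (hx : x ∉ M) (k : Fin n) :
    ContinuousOn (fun z : Fin n → ℂ =>
      star (z k - x k) / ∑ i, (z i - x i) * star (z i - x i)) M := by
  refine ContinuousOn.div (by fun_prop) (by fun_prop) fun z hz h0 => ?_
  have := sum_mul_star_div (z := z) (x := x) fun h => hx (h ▸ hz)
  simp only [h0, div_zero, mul_zero, Finset.sum_const_zero, zero_ne_one] at this

/-- A point off a Carleman continuum is peaked by an entire function small on the continuum. -/
theorem IsCarleman.exists_eq_one_norm_lt (hM : IsCarleman M) {x : Fin n → ℂ} (hx : x ∉ M)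
    {η : ℝ} (hη : 0 < η) :
    ∃ g : (Fin n → ℂ) → ℂ, Differentiable ℂ g ∧ g x = 1 ∧ ∀ z ∈ M, ‖g z‖ ≤ η := by
  have hq := fun k => hM _ (continuousOn_star_div hx k)
    (fun z => η / ((n + 1) * (1 + ‖z - x‖)))
    (ContinuousOn.div (by fun_prop) (by fun_prop) fun z _ => by positivity)
    (fun z _ => by positivity)
  choose q hqd hq using hq
  refine ⟨fun z => 1 - ∑ k, (z k - x k) * q k z, by fun_prop, by simp, fun z hz => ?_⟩
  have h1 := sum_mul_star_div (z := z) (x := x) fun h => hx (h ▸ hz)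
  change ‖1 - ∑ k, (z k - x k) * q k z‖ ≤ η
  rw [← h1, ← Finset.sum_sub_distrib]
  calc _ ≤ ∑ _k : Fin n, ‖z - x‖ * (η / ((n + 1) * (1 + ‖z - x‖))) := by
        refine norm_sum_le_of_le _ fun k _ => ?_
        rw [← mul_sub, norm_mul, norm_sub_rev _ (q k z)]
        exact mul_le_mul (norm_le_pi_norm (z - x) k) (hq k z hz).le (norm_nonneg _)
          (norm_nonneg _)
    _ = (n * ‖z - x‖ / ((n + 1) * (1 + ‖z - x‖))) * η := by
        rw [Finset.sum_const, Finset.card_univ, Fintype.card_fin, nsmul_eq_mul]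
        ring
    _ ≤ 1 * η := by
        gcongr
        rw [div_le_one (by positivity)]
        gcongr <;> linarith
    _ = η := one_mul η

/-- Baire category upgrades Carleman approximation to an approximation with uniform control on a
prescribed compact set. -/
theorem IsCarleman.exists_uniform_bound (hM : IsCarleman M) {K : Set (Fin n → ℂ)}
    (hK : IsCompact K) {w ε : (Fin n → ℂ) → ℝ} (hw : ContinuousOn w M) (hw0 : ∀ z ∈ M, 0 < w z)
    (hε : ContinuousOn ε M) (hε0 : ∀ z ∈ M, 0 < ε z) :
    ∃ C : ℝ, 0 < C ∧ ∀ u : (Fin n → ℂ) → ℂ, ContinuousOn u M → (∀ z ∈ M, ‖u z‖ ≤ w z) →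
      ∀ δ : ℝ, 0 < δ → ∃ f : (Fin n → ℂ) → ℂ, Differentiable ℂ f ∧
        (∀ z ∈ M, ‖f z - u z‖ ≤ C * (ε z + δ * w z)) ∧ ∀ z ∈ K, ‖f z‖ ≤ C := by
  classical
  let U : ℕ → Set (BoundedContinuousFunction M ℂ) := fun m =>
    {v | ∃ f : (Fin n → ℂ) → ℂ, Differentiable ℂ f ∧
      (∀ z : M, ‖f z - w z * v z‖ ≤ ε z) ∧ ∀ z ∈ K, ‖f z‖ ≤ m}
  have hU : ⋃ m, closure (U m) = Set.univ := by
    refine Set.eq_univ_of_forall fun v => ?_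
    obtain ⟨f, hf, hfv⟩ := hM (fun z => w z * if h : z ∈ M then v ⟨z, h⟩ else 0)
      (by
        refine ContinuousOn.mul (Complex.continuous_ofReal.comp_continuousOn hw) ?_
        rw [continuousOn_iff_continuous_domRestrict]
        convert v.continuous using 1
        ext z
        simp) ε hε hε0
    obtain ⟨B, hB⟩ := hK.exists_bound_of_continuousOn hf.continuous.continuousOn
    obtain ⟨m, hm⟩ := exists_nat_ge B
    refine Set.mem_iUnion.2 ⟨m, subset_closure ⟨f, hf, fun z => ?_, fun z hz =>
      (hB z hz).trans hm⟩⟩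
    simpa using (hfv z z.2).le
  obtain ⟨m, v₀, hv₀⟩ := nonempty_interior_of_iUnion_of_closed (fun m => isClosed_closure) hU
  obtain ⟨r, hr, hball⟩ := Metric.isOpen_iff.1 isOpen_interior v₀ hv₀
  have happ : ∀ v : BoundedContinuousFunction M ℂ, ‖v - v₀‖ < r → ∀ δ : ℝ, 0 < δ →
      ∃ f : (Fin n → ℂ) → ℂ, Differentiable ℂ f ∧
      (∀ z : M, ‖f z - w z * v z‖ ≤ ε z + δ * w z) ∧ ∀ z ∈ K, ‖f z‖ ≤ m := by
    intro v hv δ hδ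
    have hv' : v ∈ closure (U m) := interior_subset (hball (by rwa [mem_ball_iff_norm]))
    obtain ⟨v', ⟨f, hf, hfv, hfK⟩, hd⟩ := Metric.mem_closure_iff.1 hv' δ hδ
    refine ⟨f, hf, fun z => ?_, hfK⟩
    have hwz := hw0 z z.2
    calc ‖f z - w z * v z‖ = ‖(f z - w z * v' z) - w z * (v z - v' z)‖ := by congr 1; ring
      _ ≤ ‖f z - w z * v' z‖ + ‖(w z : ℂ) * (v z - v' z)‖ := norm_sub_le _ _
      _ ≤ ε z + w z * δ := by
          refine add_le_add (hfv z) ?_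
          rw [norm_mul, Complex.norm_real, Real.norm_of_nonneg hwz.le]
          gcongr
          rw [← dist_eq_norm]
          exact (BoundedContinuousFunction.dist_coe_le_dist z).trans hd.le
      _ = ε z + δ * w z := by ring
  refine ⟨4 / r * (m + 1), by positivity, fun u hu huw δ hδ => ?_⟩
  let v : BoundedContinuousFunction M ℂ := BoundedContinuousFunction.ofNormedAddCommGroup
    (fun z => u z / w z)
    ((continuousOn_iff_continuous_domRestrict.1 hu).div
      (Complex.continuous_ofReal.comp (continuousOn_iff_continuous_domRestrict.1 hw))
      fun z => by simpa using (hw0 z z.2).ne') 1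
    (fun z => by
      rw [norm_div, Complex.norm_real, Real.norm_of_nonneg (hw0 z z.2).le]
      exact (div_le_one (hw0 z z.2)).2 (huw z z.2))
  have hv1 : ‖v‖ ≤ 1 := BoundedContinuousFunction.norm_ofNormedAddCommGroup_le _ zero_le_one _
  obtain ⟨f₁, hf₁, hfv₁, hfK₁⟩ := happ (v₀ + ((r / 2 : ℝ) : ℂ) • v) (by
    rw [add_sub_cancel_left, norm_smul, Complex.norm_real, Real.norm_of_nonneg (by positivity)]
    nlinarith) δ hδ
  obtain ⟨f₂, hf₂, hfv₂, hfK₂⟩ := happ v₀ (by simpa using hr) δ hδ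
  have hrC : ((r : ℝ) : ℂ) ≠ 0 := by exact_mod_cast hr.ne'
  refine ⟨fun z => ((2 / r : ℝ) : ℂ) * (f₁ z - f₂ z), by fun_prop, fun z hz => ?_, fun z hz => ?_⟩
  · have hwz := hw0 z hz
    have hwC : ((w z : ℝ) : ℂ) ≠ 0 := by exact_mod_cast hwz.ne'
    have e1 := hfv₁ ⟨z, hz⟩
    have e2 := hfv₂ ⟨z, hz⟩
    have hE : 0 ≤ ε z + δ * w z := (norm_nonneg _).trans e2
    have key : ((2 / r : ℝ) : ℂ) * (f₁ z - f₂ z) - u z = ((2 / r : ℝ) : ℂ) *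
        ((f₁ z - w z * (v₀ + ((r / 2 : ℝ) : ℂ) • v) ⟨z, hz⟩) - (f₂ z - w z * v₀ ⟨z, hz⟩)) := by
      have : v ⟨z, hz⟩ = u z / w z := rfl
      simp only [BoundedContinuousFunction.coe_add, BoundedContinuousFunction.coe_smul,
        Pi.add_apply, this, smul_eq_mul]
      push_cast
      field_simp
      ring
    rw [key, norm_mul, Complex.norm_real, Real.norm_of_nonneg (by positivity)]
    calc _ ≤ 2 / r * ((ε z + δ * w z) + (ε z + δ * w z)) := by
          gcongr
          exact (norm_sub_le _ _).trans (add_le_add e1 e2)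
      _ = 4 / r * 1 * (ε z + δ * w z) := by ring
      _ ≤ 4 / r * (m + 1) * (ε z + δ * w z) := by
          gcongr
          simp
  · rw [norm_mul, Complex.norm_real, Real.norm_of_nonneg (by positivity)]
    calc _ ≤ 2 / r * ((m : ℝ) + m) := by
          gcongr
          exact (norm_sub_le _ _).trans (add_le_add (hfK₁ z hz) (hfK₂ z hz))
      _ = 4 / r * m := by ring
      _ ≤ 4 / r * (m + 1) := by gcongr; simp

end Carleman

section BoundedHulls

variable {n : ℕ} {M : Set (Fin n → ℂ)}

theorem exists_continuousOn_dominating {a : ℕ → (Fin n → ℂ) → ℝ}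
    (ha : ∀ j, ContinuousOn (a j) M) (ha0 : ∀ j z, 0 ≤ a j z)
    (hz : ∀ (j : ℕ) z, ‖z‖ ≤ j → a j z = 0) :
    ∃ w : (Fin n → ℂ) → ℝ, ContinuousOn w M ∧ (∀ z, 1 ≤ w z) ∧ ∀ j z, a j z ≤ w z := by
  have hfin : ∀ z, (Function.support fun j => a j z).Finite := by
    intro z
    obtain ⟨m, hm⟩ := exists_nat_ge ‖z‖
    refine (Set.finite_lt_nat m).subset fun j hj => ?_
    by_contra h
    exact hj (hz j z (hm.trans (by exact_mod_cast not_lt.1 h)))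
  refine ⟨fun z => 1 + ∑ᶠ j, a j z, continuousOn_const.add ?_, fun z => ?_, fun j z => ?_⟩
  · rw [continuousOn_iff_continuous_domRestrict]
    refine continuous_finsum (f := fun j (z : M) => a j z)
      (fun j => continuousOn_iff_continuous_domRestrict.1 (ha j)) fun z => ?_
    obtain ⟨m, hm⟩ := exists_nat_gt ‖(z : Fin n → ℂ)‖
    refine ⟨{y : M | ‖(y : Fin n → ℂ)‖ < m},
      (isOpen_lt (by fun_prop) continuous_const).mem_nhds hm, ?_⟩
    refine (Set.finite_lt_nat m).subset ?_
    rintro j ⟨y, hy, hym⟩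
    by_contra h
    have hym' : ‖(y : Fin n → ℂ)‖ < m := hym
    exact hy (hz j y (hym'.le.trans (by exact_mod_cast not_lt.1 h)))
  · have := finsum_nonneg fun j => ha0 j z
    linarith
  · have := single_le_finsum j (f := fun j => a j z) (hfin z) fun j => ha0 j z
    linarith

/-- The part of the hull off `K ∪ M` already lies in the hull of a single compact piece; in
particular a Carleman continuum has bounded E-hulls. -/
theorem IsCarleman.exists_hHull_subset (hMc : IsClosed M) (hM : IsCarleman M)
    {K : Set (Fin n → ℂ)} (hK : IsCompact K) :
    ∃ R : ℝ, hHull (K ∪ M) ⊆ polyHullCompact (K ∪ M ∩ Metric.closedBall 0 R) := by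
  by_contra! hcon
  have hcpt : ∀ R : ℝ, IsCompact (K ∪ M ∩ Metric.closedBall 0 R) := fun R =>
    hK.union ((isCompact_closedBall 0 R).inter_left hMc)
  have hx : ∀ j : ℕ, ∃ x ∈ hHull (K ∪ M),
      x ∉ polyHullCompact (K ∪ M ∩ Metric.closedBall 0 ((j : ℝ) + 1)) := fun j =>
    Set.not_subset.1 (hcon _)
  choose x hxh hxn using hx
  have hp := fun j => exists_eval_eq_one_of_notMem_polyHullCompact (hcpt _) (hxn j)
    (η := 1 / 2) (by norm_num)
  choose p hp1 hp2 using hp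
  have hxM : ∀ j, x j ∉ M := fun j h => (hxh j).2 (Or.inr h)
  let ψ : ℕ → (Fin n → ℂ) → ℝ := fun j z => max 0 (min 1 (‖z‖ - j))
  have hψc : ∀ j, Continuous (ψ j) := fun j => by fun_prop
  have hψ0 : ∀ j z, 0 ≤ ψ j z := fun j z => le_max_left _ _
  have hψ1 : ∀ j z, ψ j z ≤ 1 := fun j z => max_le zero_le_one (min_le_left _ _)
  have hψz : ∀ (j : ℕ) z, ‖z‖ ≤ j → ψ j z = 0 := fun j z h =>
    max_eq_left ((min_le_right _ _).trans (by linarith))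
  have hψo : ∀ (j : ℕ) z, (j : ℝ) + 1 ≤ ‖z‖ → ψ j z = 1 := fun j z h => by
    simp only [ψ]
    rw [min_eq_left (by linarith), max_eq_right zero_le_one]
  let s : ℕ → ℝ := fun j => (j + 1) * (1 + ‖x j‖)
  have hs : ∀ j, 0 < s j := fun j => by positivity
  let u : ℕ → Fin n → (Fin n → ℂ) → ℂ := fun j k z => (s j : ℂ) * (ψ j z : ℂ) *
    MvPolynomial.eval z (p j) *
      (star (z k - x j k) / ∑ i, (z i - x j i) * star (z i - x j i))
  have huc : ∀ j k, ContinuousOn (u j k) M := fun j k => by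
    refine ContinuousOn.mul (Continuous.continuousOn ?_) (continuousOn_star_div (hxM j) k)
    exact (continuous_const.mul (Complex.continuous_ofReal.comp (hψc j))).mul
      (MvPolynomial.continuous_eval (p j))
  obtain ⟨w, hwc, hw1, hw⟩ := exists_continuousOn_dominating (M := M)
    (a := fun j z => ∑ k, ‖u j k z‖)
    (fun j => continuousOn_finsetSum _ fun k _ => (huc j k).norm)
    (fun j z => Finset.sum_nonneg fun k _ => norm_nonneg _)
    (fun j z h => Finset.sum_eq_zero fun k _ => by simp [u, hψz j z h])
  have hw0 : ∀ z, 0 < w z := fun z => zero_lt_one.trans_le (hw1 z)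
  obtain ⟨C, hC, happ⟩ := hM.exists_uniform_bound hK hwc (fun z _ => hw0 z)
    (ε := fun z => 1 / (1 + ‖z‖))
    (ContinuousOn.div (by fun_prop) (by fun_prop) fun z _ => by positivity)
    (fun z _ => by positivity)
  obtain ⟨B, hB⟩ := hK.isBounded.exists_norm_le
  obtain ⟨j, hj⟩ := exists_nat_ge (4 * (n * (2 + max B 0) * C))
  have hj1 : n * (2 + max B 0) * C / (j + 1) ≤ 1 / 4 := by
    rw [div_le_iff₀ (by positivity)]
    linarith
  obtain ⟨D, ⟨hD, hDs⟩, hxD⟩ := Set.mem_iUnion₂.1 (hxh j).1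
  have hDM : IsCompact (D ∩ M) := hD.inter_right hMc
  obtain ⟨W, hW⟩ := hDM.exists_bound_of_continuousOn
    (f := fun z => (1 + ‖z‖) * w z) ((by fun_prop : Continuous fun z : Fin n → ℂ =>
      1 + ‖z‖).continuousOn.mul (hwc.mono Set.inter_subset_right))
  have hδ : 0 < 1 / (max W 0 + 1) := by positivity
  have hf := fun k => happ (u j k) (huc j k) (fun z _ =>
    (Finset.single_le_sum (f := fun k => ‖u j k z‖) (fun k _ => norm_nonneg _)
      (Finset.mem_univ k)).trans (hw j z)) _ hδ
  choose f hfd hfM hfK using hf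
  have hpd : Differentiable ℂ fun z : Fin n → ℂ => MvPolynomial.eval z (p j) := by
    intro z
    exact (AnalyticOnNhd.eval_mvPolynomial (p j) z (Set.mem_univ z)).differentiableAt
  have hsC : ((s j : ℝ) : ℂ) ≠ 0 := by exact_mod_cast (hs j).ne'
  have hbk : ∀ (z : Fin n → ℂ) (k : Fin n), ‖z k - x j k‖ / s j ≤ (1 + ‖z‖) / (j + 1) := by
    intro z k
    rw [div_le_div_iff₀ (hs j) (by positivity)]
    have h1 : ‖z k - x j k‖ ≤ ‖z‖ + ‖x j‖ :=
      (norm_le_pi_norm (z - x j) k).trans (norm_sub_le _ _)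
    have h2 : ‖z‖ + ‖x j‖ ≤ (1 + ‖z‖) * (1 + ‖x j‖) := by
      nlinarith [norm_nonneg z, norm_nonneg (x j), mul_nonneg (norm_nonneg z) (norm_nonneg (x j))]
    calc _ ≤ ((1 + ‖z‖) * (1 + ‖x j‖)) * (j + 1) := by gcongr; exact h1.trans h2
      _ = (1 + ‖z‖) * s j := by simp only [s]; ring
  let T : (Fin n → ℂ) → ℂ := fun z =>
    MvPolynomial.eval z (p j) - ∑ k, (z k - x j k) * (f k z / s j)
  have hT : Differentiable ℂ T :=
    hpd.sub (by fun_prop)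
  have hTx : T (x j) = 1 := by simp [T, hp1]
  have hTD : ∀ z ∈ D, ‖T z‖ ≤ 3 / 4 := by
    intro z hzD
    rcases hDs hzD with hzK | hzM
    · calc ‖T z‖ ≤ ‖MvPolynomial.eval z (p j)‖ + ‖∑ k, (z k - x j k) * (f k z / s j)‖ :=
            norm_sub_le _ _
        _ ≤ 1 / 2 + ∑ _k : Fin n, (1 + max B 0) / (j + 1) * C := by
            refine add_le_add (hp2 j z (Or.inl hzK)) (norm_sum_le_of_le _ fun k _ => ?_)
            rw [norm_mul, norm_div, Complex.norm_real, Real.norm_of_nonneg (hs j).le,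
              mul_div_left_comm, mul_comm]
            refine mul_le_mul ((hbk z k).trans ?_) (hfK k z hzK) (norm_nonneg _) (by positivity)
            gcongr
            exact (hB z hzK).trans (le_max_left _ _)
        _ = 1 / 2 + n * (1 + max B 0) * C / (j + 1) := by
            rw [Finset.sum_const, Finset.card_univ, Fintype.card_fin, nsmul_eq_mul]
            ring
        _ ≤ 1 / 2 + n * (2 + max B 0) * C / (j + 1) := by gcongr; norm_num
        _ ≤ 3 / 4 := by linarith
    · have hzx : z ≠ x j := fun h => hxM j (h ▸ hzM)
      have hsum : ∑ k, (z k - x j k) * (u j k z / s j) =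
          (ψ j z : ℂ) * MvPolynomial.eval z (p j) := by
        rw [← mul_one ((ψ j z : ℂ) * MvPolynomial.eval z (p j)), ← sum_mul_star_div hzx,
          Finset.mul_sum]
        refine Finset.sum_congr rfl fun k _ => ?_
        simp only [u]
        field_simp
      have hTz : T z = ((1 - ψ j z : ℝ) : ℂ) * MvPolynomial.eval z (p j) -
          ∑ k, (z k - x j k) * ((f k z - u j k z) / s j) := by
        simp only [T, sub_div, mul_sub, Finset.sum_sub_distrib]
        push_cast
        linear_combination -hsum
      have hψp : ‖((1 - ψ j z : ℝ) : ℂ) * MvPolynomial.eval z (p j)‖ ≤ 1 / 2 := by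
        rcases le_total ((j : ℝ) + 1) ‖z‖ with h | h
        · simp [hψo j z h]
        · rw [norm_mul, Complex.norm_real, Real.norm_of_nonneg (by linarith [hψ1 j z])]
          have := hp2 j z (Or.inr ⟨hzM, by simpa using h⟩)
          nlinarith [hψ0 j z, hψ1 j z, norm_nonneg (MvPolynomial.eval z (p j))]
      have herr : (1 + ‖z‖) * (1 / (1 + ‖z‖) + 1 / (max W 0 + 1) * w z) ≤ 2 := by
        have h1 : (1 + ‖z‖) * (1 / (1 + ‖z‖)) = 1 := mul_one_div_cancel (by positivity)
        have h2 : (1 + ‖z‖) * w z ≤ max W 0 + 1 :=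
          (le_abs_self _).trans ((hW z ⟨hzD, hzM⟩).trans ((le_max_left _ _).trans (by linarith)))
        have h3 : (1 + ‖z‖) * (1 / (max W 0 + 1) * w z) ≤ 1 := by
          rw [show (1 + ‖z‖) * (1 / (max W 0 + 1) * w z) =
            ((1 + ‖z‖) * w z) / (max W 0 + 1) by ring]
          exact (div_le_one (by positivity)).2 h2
        linarith
      rw [hTz]
      calc _ ≤ 1 / 2 + ∑ _k : Fin n, 2 * C / (j + 1) := by
            refine (norm_sub_le _ _).trans (add_le_add hψp (norm_sum_le_of_le _ fun k _ => ?_))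
            rw [norm_mul, norm_div, Complex.norm_real, Real.norm_of_nonneg (hs j).le,
              mul_div_left_comm, mul_comm]
            calc _ ≤ (1 + ‖z‖) / (j + 1) *
                  (C * (1 / (1 + ‖z‖) + 1 / (max W 0 + 1) * w z)) := by
                  exact mul_le_mul (hbk z k) (hfM k z hzM) (norm_nonneg _) (by positivity)
              _ = ((1 + ‖z‖) * (1 / (1 + ‖z‖) + 1 / (max W 0 + 1) * w z)) * C / (j + 1) := by
                  ring
              _ ≤ 2 * C / (j + 1) := by gcongr
        _ = 1 / 2 + n * (2 + 0) * C / (j + 1) := by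
            rw [Finset.sum_const, Finset.card_univ, Fintype.card_fin, nsmul_eq_mul]
            ring
        _ ≤ 1 / 2 + n * (2 + max B 0) * C / (j + 1) := by gcongr; exact le_max_right _ _
        _ ≤ 3 / 4 := by linarith
  have := norm_le_of_mem_polyHullCompact hD hxD hT (by norm_num) hTD
  rw [hTx, norm_one] at this
  norm_num at this

theorem IsCarleman.isCompact_union_closure_hHull (hMc : IsClosed M) (hM : IsCarleman M)
    {K : Set (Fin n → ℂ)} (hK : IsCompact K) : IsCompact (K ∪ closure (hHull (K ∪ M))) := by
  obtain ⟨R, hR⟩ := hM.exists_hHull_subset hMc hK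
  have hD : IsCompact (K ∪ M ∩ Metric.closedBall 0 R) :=
    hK.union ((isCompact_closedBall 0 R).inter_left hMc)
  exact hK.union ((isCompact_polyHullCompact hD).closure_of_subset hR)

theorem IsCarleman.isPolyConvex_union_closure_hHull (hMc : IsClosed M) (hM : IsCarleman M)
    {K : Set (Fin n → ℂ)} (hK : IsCompact K) :
    IsPolyConvex (K ∪ closure (hHull (K ∪ M)) ∪ M) := by
  obtain ⟨R, hR⟩ := hM.exists_hHull_subset hMc hK
  have hD : IsCompact (K ∪ M ∩ Metric.closedBall 0 R) :=
    hK.union ((isCompact_closedBall 0 R).inter_left hMc)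
  have hcl : closure (hHull (K ∪ M)) ⊆ polyHullCompact (K ∪ M ∩ Metric.closedBall 0 R) :=
    closure_minimal hR (isClosed_polyHullCompact _)
  refine Set.sdiff_eq_empty.2 (Set.iUnion₂_subset ?_)
  rintro C ⟨hC, hCs⟩ z hz
  have hE : IsCompact (K ∪ M ∩ Metric.closedBall 0 R ∪ C ∩ M) :=
    hD.union (hC.inter_right hMc)
  have hmono : polyHullCompact (K ∪ M ∩ Metric.closedBall 0 R) ⊆
      polyHullCompact (K ∪ M ∩ Metric.closedBall 0 R ∪ C ∩ M) :=
    polyHullCompact_subset (Set.subset_union_left.trans (subset_polyHullCompact hE))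
  have hCE : C ⊆ polyHullCompact (K ∪ M ∩ Metric.closedBall 0 R ∪ C ∩ M) := by
    intro y hy
    rcases hCs hy with (h | h) | h
    · exact subset_polyHullCompact hE (Or.inl (Or.inl h))
    · exact hmono (hcl h)
    · exact subset_polyHullCompact hE (Or.inr ⟨hy, h⟩)
  have hzE : z ∈ polyHull (K ∪ M) := by
    refine Set.mem_iUnion₂.2 ⟨_, ⟨hE, ?_⟩, polyHullCompact_subset hCE hz⟩
    rintro y ((h | h) | h)
    exacts [Or.inl h, Or.inr h.1, Or.inr h.2]
  by_cases h : z ∈ K ∪ M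
  · rcases h with h | h
    exacts [Or.inl (Or.inl h), Or.inr h]
  · exact Or.inl (Or.inr (subset_closure ⟨hzE, h⟩))

end BoundedHulls

section Products

variable {n n₁ n₂ : ℕ}

theorem ApproxProp.exists_peak {M K : Set (Fin n → ℂ)} (hM : ApproxProp M) (hK : IsCompact K)
    (hKM : IsPolyConvex (K ∪ M)) {y : Fin n → ℂ} (hyM : y ∈ M) (hyK : y ∉ K) {η : ℝ}
    (hη : 0 < η) :
    ∃ f : (Fin n → ℂ) → ℂ, Differentiable ℂ f ∧ 1 - η ≤ ‖f y‖ ∧ (∀ z ∈ K, ‖f z‖ ≤ η) ∧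
      ∀ z ∈ M, ‖f z‖ ≤ 1 + η := by
  obtain ⟨d, hd, hdK⟩ := Metric.isOpen_iff.1 hK.isClosed.isOpen_compl y hyK
  let b : (Fin n → ℂ) → ℝ := fun z => max 0 (1 - dist z y / (d / 2))
  have hb0 : ∀ z, z ∉ Metric.closedBall y (d / 2) → b z = 0 := by
    intro z hz
    rw [Metric.mem_closedBall, not_le] at hz
    refine max_eq_left (sub_nonpos.2 ((one_le_div (by positivity)).2 hz.le))
  have hKb : K ⊆ (Metric.closedBall y (d / 2))ᶜ := by
    intro z hz h
    exact hdK (Metric.closedBall_subset_ball (by linarith) h) hz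
  have hbc : Continuous fun z => (b z : ℂ) := by
    refine Complex.continuous_ofReal.comp ?_
    simp only [b]
    fun_prop
  obtain ⟨f, hf, hfb⟩ := hM K hK hKM (fun z => (b z : ℂ)) hbc.continuousOn
    ⟨_, Metric.isClosed_closedBall.isOpen_compl, hKb,
      (differentiableOn_const 0).congr fun z hz => by simp [hb0 z hz]⟩
    (fun _ => η) continuousOn_const fun _ _ => hη
  refine ⟨f, hf, ?_, fun z hz => ?_, fun z hz => ?_⟩
  · have h1 := (hfb y (Or.inr hyM)).le
    have h2 : b y = 1 := by simp [b]
    rw [h2, norm_sub_rev] at h1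
    have h3 := norm_sub_norm_le ((1 : ℝ) : ℂ) (f y)
    simp only [Complex.ofReal_one, norm_one] at h1 h3
    linarith
  · have h1 := (hfb z (Or.inl hz)).le
    simpa [hb0 z (hKb hz)] using h1
  · have h1 := (hfb z (Or.inr hz)).le
    have h2 : ‖(b z : ℂ)‖ ≤ 1 := by
      rw [Complex.norm_real, Real.norm_of_nonneg (le_max_left _ _)]
      exact max_le zero_le_one (by have : 0 ≤ dist z y / (d / 2) := by positivity
                                   linarith)
    have h3 := norm_le_norm_add_norm_sub (b z : ℂ) (f z)
    rw [norm_sub_rev] at h3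
    linarith

theorem mem_polyHullCompact_image {C : Set (Fin n₁ → ℂ)} {z : Fin n₁ → ℂ}
    (hz : z ∈ polyHullCompact C) (σ : Fin n₂ → Fin n₁) :
    z ∘ σ ∈ polyHullCompact ((fun w => w ∘ σ) '' C) := by
  intro p
  have := hz (MvPolynomial.rename σ p)
  simpa [MvPolynomial.eval_rename, Set.image_image] using this

/-- The product test function excluding points of `K₁ × M₂` off `M₁` and off `K₂`. -/
theorem exists_separating_pair {M₁ K₁ : Set (Fin n₁ → ℂ)} {M₂ K₂ : Set (Fin n₂ → ℂ)}
    (hM₁ : IsCarleman M₁) (hK₁ : IsCompact K₁) (hM₂ : ApproxProp M₂) (hK₂ : IsCompact K₂)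
    (hKM₂ : IsPolyConvex (K₂ ∪ M₂)) {x : Fin n₁ → ℂ} (hx : x ∉ M₁) {y : Fin n₂ → ℂ}
    (hyM : y ∈ M₂) (hyK : y ∉ K₂) :
    ∃ (g : (Fin n₁ → ℂ) → ℂ) (f : (Fin n₂ → ℂ) → ℂ), Differentiable ℂ g ∧ Differentiable ℂ f ∧
      1 / 2 < ‖g x * f y‖ ∧ (∀ z ∈ K₁, ∀ w ∈ K₂, ‖g z * f w‖ ≤ 1 / 2) ∧
      ∀ z ∈ M₁, ∀ w ∈ M₂, ‖g z * f w‖ ≤ 1 / 2 := by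
  obtain ⟨g, hg, hgx, hgM⟩ := hM₁.exists_eq_one_norm_lt hx (η := 1 / 4) (by norm_num)
  obtain ⟨B, hB⟩ := hK₁.exists_bound_of_continuousOn hg.continuous.continuousOn
  have hB0 : 0 ≤ max B 0 := le_max_right _ _
  have hη4 : 1 / (4 * (max B 0 + 1)) ≤ 1 / 4 :=
    one_div_le_one_div_of_le (by norm_num) (by linarith)
  have hηB : max B 0 * (1 / (4 * (max B 0 + 1))) ≤ 1 / 4 := by
    rw [mul_one_div, div_le_div_iff₀ (by positivity) (by norm_num)]
    linarith
  obtain ⟨f, hf, hfy, hfK, hfM⟩ := hM₂.exists_peak hK₂ hKM₂ hyM hyK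
    (η := 1 / (4 * (max B 0 + 1))) (by positivity)
  refine ⟨g, f, hg, hf, ?_, fun z hz w hw => ?_, fun z hz w hw => ?_⟩
  · rw [hgx, one_mul]
    linarith
  · rw [norm_mul]
    calc _ ≤ max B 0 * (1 / (4 * (max B 0 + 1))) :=
          mul_le_mul ((hB z hz).trans (le_max_left _ _)) (hfK w hw) (norm_nonneg _) hB0
      _ ≤ 1 / 2 := by linarith
  · rw [norm_mul]
    calc _ ≤ 1 / 4 * (1 + 1 / 4) :=
          mul_le_mul (hgM z hz) ((hfM w hw).trans (by linarith)) (norm_nonneg _) (by norm_num)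
      _ ≤ 1 / 2 := by norm_num

end Products

/-- `(K₁ × K₂) ∪ (M₁ × M₂)` is polynomially convex, where
`K_j = K̃_j ∪ closure (h(K̃_j ∪ M_j))`. -/
theorem prod_union_polyConvex {n₁ n₂ : ℕ}
    (M₁ : Set (Fin n₁ → ℂ)) (M₂ : Set (Fin n₂ → ℂ))
    (hM₁closed : IsClosed M₁) (hM₂closed : IsClosed M₂)
    (hM₁car : IsCarleman M₁) (hM₂car : IsCarleman M₂)
    (hM₁ap : ApproxProp M₁) (hM₂ap : ApproxProp M₂)
    (K₁' : Set (Fin n₁ → ℂ)) (K₂' : Set (Fin n₂ → ℂ))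
    (hK₁' : IsCompact K₁') (hK₂' : IsCompact K₂') :
    IsPolyConvex
      (prodSet (K₁' ∪ closure (hHull (K₁' ∪ M₁))) (K₂' ∪ closure (hHull (K₂' ∪ M₂)))
        ∪ prodSet M₁ M₂) := by
  set K₁ := K₁' ∪ closure (hHull (K₁' ∪ M₁)) with hK₁def
  set K₂ := K₂' ∪ closure (hHull (K₂' ∪ M₂)) with hK₂def
  have hK₁ : IsCompact K₁ := hM₁car.isCompact_union_closure_hHull hM₁closed hK₁'
  have hK₂ : IsCompact K₂ := hM₂car.isCompact_union_closure_hHull hM₂closed hK₂'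
  have hKM₁ : IsPolyConvex (K₁ ∪ M₁) := hM₁car.isPolyConvex_union_closure_hHull hM₁closed hK₁'
  have hKM₂ : IsPolyConvex (K₂ ∪ M₂) := hM₂car.isPolyConvex_union_closure_hHull hM₂closed hK₂'
  refine Set.sdiff_eq_empty.2 (Set.iUnion₂_subset ?_)
  rintro C ⟨hC, hCs⟩ z hz
  set x : Fin n₁ → ℂ := z ∘ Fin.castAdd n₂ with hxdef
  set y : Fin n₂ → ℂ := z ∘ Fin.natAdd n₁ with hydef
  have hx : x ∈ K₁ ∪ M₁ := by
    refine Set.sdiff_eq_empty.1 hKM₁ (Set.mem_iUnion₂.2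
      ⟨_, ⟨hC.image (by fun_prop), ?_⟩, mem_polyHullCompact_image hz (Fin.castAdd n₂)⟩)
    rintro _ ⟨w, hw, rfl⟩
    exact (hCs hw).imp And.left And.left
  have hy : y ∈ K₂ ∪ M₂ := by
    refine Set.sdiff_eq_empty.1 hKM₂ (Set.mem_iUnion₂.2
      ⟨_, ⟨hC.image (by fun_prop), ?_⟩, mem_polyHullCompact_image hz (Fin.natAdd n₁)⟩)
    rintro _ ⟨w, hw, rfl⟩
    exact (hCs hw).imp And.right And.right
  have hπ₁ : Differentiable ℂ fun w : Fin (n₁ + n₂) → ℂ => (w ∘ Fin.castAdd n₂ : Fin n₁ → ℂ) :=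
    differentiable_pi.2 fun i => differentiable_apply _
  have hπ₂ : Differentiable ℂ fun w : Fin (n₁ + n₂) → ℂ => (w ∘ Fin.natAdd n₁ : Fin n₂ → ℂ) :=
    differentiable_pi.2 fun i => differentiable_apply _
  have hle : ∀ (g : (Fin n₁ → ℂ) → ℂ) (f : (Fin n₂ → ℂ) → ℂ), Differentiable ℂ g →
      Differentiable ℂ f → (∀ z ∈ K₁, ∀ w ∈ K₂, ‖g z * f w‖ ≤ 1 / 2) →
      (∀ z ∈ M₁, ∀ w ∈ M₂, ‖g z * f w‖ ≤ 1 / 2) → ‖g x * f y‖ ≤ 1 / 2 := by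
    intro g f hg hf hgfK hgfM
    refine norm_le_of_mem_polyHullCompact hC hz
      (F := fun w => g (w ∘ Fin.castAdd n₂) * f (w ∘ Fin.natAdd n₁))
      ((hg.comp hπ₁).mul (hf.comp hπ₂)) (by norm_num) fun w hw => ?_
    rcases hCs hw with h | h
    exacts [hgfK _ h.1 _ h.2, hgfM _ h.1 _ h.2]
  by_contra hzn
  have hKn : ¬(x ∈ K₁ ∧ y ∈ K₂) := fun h => hzn (Or.inl h)
  have hMn : ¬(x ∈ M₁ ∧ y ∈ M₂) := fun h => hzn (Or.inr h)
  by_cases hxM : x ∈ M₁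
  · have hyM : y ∉ M₂ := fun h => hMn ⟨hxM, h⟩
    have hyK : y ∈ K₂ := hy.resolve_right hyM
    have hxK : x ∉ K₁ := fun h => hKn ⟨h, hyK⟩
    obtain ⟨g, f, hg, hf, h1, h2, h3⟩ :=
      exists_separating_pair hM₂car hK₂ hM₁ap hK₁ hKM₁ hyM hxM hxK
    rw [mul_comm] at h1
    exact h1.not_ge (hle f g hf hg (fun z hz w hw => mul_comm (g w) (f z) ▸ h2 w hw z hz)
      fun z hz w hw => mul_comm (g w) (f z) ▸ h3 w hw z hz)
  · have hxK : x ∈ K₁ := hx.resolve_right hxM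
    have hyK : y ∉ K₂ := fun h => hKn ⟨hxK, h⟩
    have hyM : y ∈ M₂ := hy.resolve_left hyK
    obtain ⟨g, f, hg, hf, h1, h2, h3⟩ :=
      exists_separating_pair hM₁car hK₁ hM₂ap hK₂ hKM₂ hxM hyM hyK
    exact h1.not_ge (hle g f hg hf h2 h3)
end
end
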